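/- Let S be a separable local operator system generating a unital locally C*-algebra A. Then S has sufficiently many admissible local boundary representations: for each λ ∈ Λ, each n ≥ 1, and each [s_ij] ∈ M_n(S), p_λⁿ([s_ij]) = max{ ‖[π(s_ij)]‖_{B(H^⊕n)} : π ∈ Ch_λ(S) }, where Ch_λ(S) is the set of admissible local boundary representations π with ‖π(a)‖ ≤ p_λ(a) for all a ∈ A. -/

import Mathlib

open scoped ComplexOrder

/-- A C*-seminorm on a complex *-algebra. -/
structure IsCstarSeminorm {A : Type*} [Ring A] [StarRing A] [Algebra ℂ A] (p : A → ℝ) : Prop where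
  nonneg : ∀ a, 0 ≤ p a
  map_zero' : p 0 = 0
  add_le : ∀ a b, p (a + b) ≤ p a + p b
  smul : ∀ (c : ℂ) (a : A), p (c • a) = ‖c‖ * p a
  mul_le : ∀ a b, p (a * b) ≤ p a * p b
  star_eq : ∀ a, p (star a) = p a
  cstar : ∀ a, p (star a * a) = p a ^ 2

/-- The family of canonical C*-seminorms on the matrix algebras `Mₙ(A)` induced by a
C*-seminorm `p` on `A`. -/
structure IsMatrixCstarSeminormFamily {A : Type*} [Ring A] [StarRing A] [Algebra ℂ A]
    (p : A → ℝ) (pn : ∀ n : ℕ, Matrix (Fin n) (Fin n) A → ℝ) : Prop where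
  cstar : ∀ n, IsCstarSeminorm (pn n)
  ker : ∀ n (M : Matrix (Fin n) (Fin n) A), pn n M = 0 ↔ ∀ i j, p (M i j) = 0
  one : ∀ a : A, pn 1 (fun _ _ => a) = p a

/-- `λ`-positivity of a matrix over `A` relative to the matrix seminorm `pn` (at level `λ`):
`M = b*b + c` with `pn c = 0`. -/
def LamPos {A : Type*} [Ring A] [StarRing A]
    (pn : ∀ n : ℕ, Matrix (Fin n) (Fin n) A → ℝ) (n : ℕ)
    (M : Matrix (Fin n) (Fin n) A) : Prop :=
  ∃ x c : Matrix (Fin n) (Fin n) A, pn n c = 0 ∧ M = star x * x + c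

/-- Positivity of a matrix of bounded operators, i.e. positivity in `B(H^{⊕n}) ≅ Mₙ(B(H))`. -/
def MatPosOp {H : Type*} [NormedAddCommGroup H] [InnerProductSpace ℂ H] [CompleteSpace H]
    {n : ℕ} (T : Matrix (Fin n) (Fin n) (H →L[ℂ] H)) : Prop :=
  ∃ X : Matrix (Fin n) (Fin n) (H →L[ℂ] H), T = star X * X

/-- The bounded operator on `H^{⊕n}` (with the `ℓ²`-Hilbert space structure) induced by an
`n × n` matrix of bounded operators on `H`. -/
noncomputable def matOp {H : Type*} [NormedAddCommGroup H] [InnerProductSpace ℂ H]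
    {n : ℕ} (T : Matrix (Fin n) (Fin n) (H →L[ℂ] H)) :
    PiLp 2 (fun _ : Fin n => H) →L[ℂ] PiLp 2 (fun _ : Fin n => H) :=
  ((PiLp.continuousLinearEquiv 2 ℂ (fun _ : Fin n => H)).symm :
      ((_ : Fin n) → H) →L[ℂ] PiLp 2 (fun _ : Fin n => H)) ∘L
    (ContinuousLinearMap.pi fun i => ∑ j, (T i j) ∘L (ContinuousLinearMap.proj j)) ∘L
    ((PiLp.continuousLinearEquiv 2 ℂ (fun _ : Fin n => H)) :
      PiLp 2 (fun _ : Fin n => H) →L[ℂ] ((_ : Fin n) → H))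

/-- A map into `B(H)` has trivial commutant (irreducibility). -/
def HasTrivialCommutant {R H : Type*} [NormedAddCommGroup H] [InnerProductSpace ℂ H]
    (φ : R → (H →L[ℂ] H)) : Prop :=
  ∀ T : H →L[ℂ] H, (∀ a, T * φ a = φ a * T) → ∃ c : ℂ, T = c • (1 : H →L[ℂ] H)

/-- Complete positivity at level `λ` for a linear map defined on all of `A`, with values in
`B(H)`: `λ`-positive matrices go to positive operator matrices, and matrices annihilated by the
`λ`-th matrix seminorm go to zero. -/
def IsLamCPmap {A H : Type*} [Ring A] [StarRing A] [Algebra ℂ A]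
    [NormedAddCommGroup H] [InnerProductSpace ℂ H] [CompleteSpace H]
    (pn : ∀ n : ℕ, Matrix (Fin n) (Fin n) A → ℝ) (φ : A →ₗ[ℂ] (H →L[ℂ] H)) : Prop :=
  (∀ (n : ℕ) (M : Matrix (Fin n) (Fin n) A), LamPos pn n M → MatPosOp (M.map φ)) ∧
  (∀ (n : ℕ) (M : Matrix (Fin n) (Fin n) A), pn n M = 0 → M.map φ = 0)

/-- Complete positivity at level `λ` for a linear map defined on a local operator system
`S ⊆ A`, with values in `B(H)`. -/
def IsLamCPmapOn {A H : Type*} [Ring A] [StarRing A] [Algebra ℂ A]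
    [NormedAddCommGroup H] [InnerProductSpace ℂ H] [CompleteSpace H]
    (pn : ∀ n : ℕ, Matrix (Fin n) (Fin n) A → ℝ) (S : Submodule ℂ A)
    (φ : ↥S →ₗ[ℂ] (H →L[ℂ] H)) : Prop :=
  (∀ (n : ℕ) (M : Matrix (Fin n) (Fin n) ↥S), LamPos pn n (M.map Subtype.val) →
      MatPosOp (M.map fun s => φ s)) ∧
  (∀ (n : ℕ) (M : Matrix (Fin n) (Fin n) ↥S), pn n (M.map Subtype.val) = 0 →
      M.map (fun s => φ s) = 0)

/-- Complete positivity (in the C*-algebraic, purely algebraic sense) of a linear map from a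
ring with involution to `B(H)`: matrices of the form `x*x` are sent to positive operator
matrices. For a C*-algebra this is the usual notion of complete positivity. -/
def IsCstarCPmap {R H : Type*} [Ring R] [StarRing R] [Algebra ℂ R]
    [NormedAddCommGroup H] [InnerProductSpace ℂ H] [CompleteSpace H]
    (φ : R →ₗ[ℂ] (H →L[ℂ] H)) : Prop :=
  ∀ (n : ℕ) (M : Matrix (Fin n) (Fin n) R),
    (∃ x : Matrix (Fin n) (Fin n) R, M = star x * x) → MatPosOp (M.map φ)

/-- A boundary representation (in the sense of Arveson) of a C*-algebra `R` for the operator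
system `T ⊆ R`: an irreducible representation which is the unique unital completely positive
extension of its restriction to `T`. -/
def IsBoundaryRep {R H : Type*} [Ring R] [StarRing R] [Algebra ℂ R]
    [NormedAddCommGroup H] [InnerProductSpace ℂ H] [CompleteSpace H]
    (T : Set R) (ψ : R →⋆ₐ[ℂ] (H →L[ℂ] H)) : Prop :=
  HasTrivialCommutant ⇑ψ ∧
  ∀ χ : R →ₗ[ℂ] (H →L[ℂ] H), χ 1 = 1 → IsCstarCPmap χ → (∀ t ∈ T, χ t = ψ t) →
    ∀ b, χ b = ψ b

/-- An admissible local boundary representation of the locally C*-algebra `A` for the local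
operator system `S ⊆ A`. -/
def IsAdmLocBdryRep {Λ A H : Type*} [Ring A] [StarRing A] [Algebra ℂ A]
    [NormedAddCommGroup H] [InnerProductSpace ℂ H] [CompleteSpace H]
    (p : Λ → A → ℝ) (pn : Λ → ∀ n : ℕ, Matrix (Fin n) (Fin n) A → ℝ)
    (S : Submodule ℂ A) (π : A →⋆ₐ[ℂ] (H →L[ℂ] H)) : Prop :=
  HasTrivialCommutant ⇑π ∧
  ∃ l₀ : Λ, (∀ a, ‖π a‖ ≤ p l₀ a) ∧
    ∀ φ : A →ₗ[ℂ] (H →L[ℂ] H), φ 1 = 1 → (∃ l, IsLamCPmap (pn l) φ) →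
      (∀ a, ‖φ a‖ ≤ p l₀ a) → (∀ s ∈ S, φ s = π s) → ∀ a, φ a = π a

/-- An admissible local completely positive map between local operator systems
`S₁ ⊆ A₁` and `S₂ ⊆ A₂` (same index set `Λ` of seminorms). -/
def IsAdmLocCP {Λ A₁ A₂ : Type*} [Ring A₁] [StarRing A₁] [Algebra ℂ A₁]
    [Ring A₂] [StarRing A₂] [Algebra ℂ A₂]
    (pn₁ : Λ → ∀ n : ℕ, Matrix (Fin n) (Fin n) A₁ → ℝ)
    (pn₂ : Λ → ∀ n : ℕ, Matrix (Fin n) (Fin n) A₂ → ℝ)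
    (S₁ : Submodule ℂ A₁) (S₂ : Submodule ℂ A₂) (φ : ↥S₁ →ₗ[ℂ] ↥S₂) : Prop :=
  ∀ (l : Λ) (n : ℕ) (M : Matrix (Fin n) (Fin n) ↥S₁),
    (LamPos (pn₁ l) n (M.map Subtype.val) →
      LamPos (pn₂ l) n (M.map fun s => ((φ s : ↥S₂) : A₂))) ∧
    (pn₁ l n (M.map Subtype.val) = 0 → pn₂ l n (M.map fun s => ((φ s : ↥S₂) : A₂)) = 0)

/-- A local completely isometric map between local operator systems. -/
def IsLocCompIsometric {Λ A₁ A₂ : Type*} [Ring A₁] [StarRing A₁] [Algebra ℂ A₁]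
    [Ring A₂] [StarRing A₂] [Algebra ℂ A₂]
    (pn₁ : Λ → ∀ n : ℕ, Matrix (Fin n) (Fin n) A₁ → ℝ)
    (pn₂ : Λ → ∀ n : ℕ, Matrix (Fin n) (Fin n) A₂ → ℝ)
    (S₁ : Submodule ℂ A₁) (S₂ : Submodule ℂ A₂) (φ : ↥S₁ →ₗ[ℂ] ↥S₂) : Prop :=
  ∀ (l : Λ) (n : ℕ) (M : Matrix (Fin n) (Fin n) ↥S₁),
    pn₂ l n (M.map fun s => ((φ s : ↥S₂) : A₂)) = pn₁ l n (M.map Subtype.val)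

/-- A completely positive map (algebraic sense) between operator systems `T₁ ⊆ R₁`, `T₂ ⊆ R₂`
sitting in C*-algebras. -/
def IsCstarCPmapOn {R₁ R₂ : Type*} [Ring R₁] [StarRing R₁] [Algebra ℂ R₁]
    [Ring R₂] [StarRing R₂] [Algebra ℂ R₂]
    (T₁ : Submodule ℂ R₁) (T₂ : Submodule ℂ R₂) (ψ : ↥T₁ →ₗ[ℂ] ↥T₂) : Prop :=
  ∀ (n : ℕ) (M : Matrix (Fin n) (Fin n) ↥T₁),
    (∃ x : Matrix (Fin n) (Fin n) R₁, M.map Subtype.val = star x * x) →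
    ∃ y : Matrix (Fin n) (Fin n) R₂, M.map (fun s => ((ψ s : ↥T₂) : R₂)) = star y * y

/-- A local boundary ideal for a local operator system `S ⊆ A`: a closed two-sided *-ideal such
that the quotient map is completely isometric on `S` with respect to the quotient matrix
seminorms. -/
def IsLocBdryIdeal {Λ A : Type*} [Ring A] [StarRing A] [Algebra ℂ A] [TopologicalSpace A]
    (pn : Λ → ∀ n : ℕ, Matrix (Fin n) (Fin n) A → ℝ) (S : Submodule ℂ A)
    (I : Set A) : Prop :=
  (∃ J : TwoSidedIdeal A, (J : Set A) = I) ∧ (∀ a ∈ I, star a ∈ I) ∧ IsClosed I ∧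
  ∀ (l : Λ) (n : ℕ) (M : Matrix (Fin n) (Fin n) ↥S),
    sInf {r : ℝ | ∃ C : Matrix (Fin n) (Fin n) A, (∀ i j, C i j ∈ I) ∧
        r = pn l n (M.map Subtype.val + C)} = pn l n (M.map Subtype.val)

open scoped InnerProductSpace

/-- A compact set has an extreme point which is lexicographically maximal for a given sequence of
continuous functionals. -/
theorem exists_extremePoint_lexMax {E : Type*} [AddCommGroup E] [Module ℝ E] [TopologicalSpace E]
    [T2Space E] [IsTopologicalAddGroup E] [ContinuousSMul ℝ E] [LocallyConvexSpace ℝ E]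
    {K : Set E} (hK : IsCompact K) (hne : K.Nonempty) (ℓ : ℕ → (E →L[ℝ] ℝ)) :
    ∃ h ∈ K.extremePoints ℝ, ∀ h' ∈ K, ∀ n, (∀ i < n, ℓ i h' = ℓ i h) → ℓ n h' ≤ ℓ n h := by
  let F : ℕ → Set E := fun n => Nat.rec K (fun n s => (ℓ n).toExposed s) n
  have hF0 : F 0 = K := rfl
  have hFs : ∀ n, F (n + 1) = (ℓ n).toExposed (F n) := fun n => rfl
  have hsub : ∀ n, F (n + 1) ⊆ F n := fun n x hx => by rw [hFs] at hx; exact hx.1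
  have hcpt : ∀ n, IsCompact (F n) := by
    intro n
    induction n with
    | zero => exact hK
    | succ n ih => exact ContinuousLinearMap.toExposed.isExposed.isCompact ih
  have hnonempty : ∀ n, (F n).Nonempty := by
    intro n
    induction n with
    | zero => exact hne
    | succ n ih =>
      obtain ⟨x, hx, hmax⟩ := (hcpt n).exists_isMaxOn ih (ℓ n).continuous.continuousOn
      exact ⟨x, hx, fun y hy => hmax hy⟩
  have hext : ∀ n, IsExtreme ℝ K (F n) := by
    intro n
    induction n with
    | zero => exact IsExtreme.rfl
    | succ n ih => exact ih.trans ContinuousLinearMap.toExposed.isExposed.isExtreme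
  have hinter : (⋂ n, F n).Nonempty :=
    IsCompact.nonempty_iInter_of_sequence_nonempty_isCompact_isClosed F hsub hnonempty (hcpt 0)
      fun n => (hcpt n).isClosed
  have hcptInter : IsCompact (⋂ n, F n) :=
    (hcpt 0).of_isClosed_subset (isClosed_iInter fun n => (hcpt n).isClosed)
      (Set.iInter_subset F 0)
  obtain ⟨h, hh⟩ := hcptInter.extremePoints_nonempty hinter
  have hmem : ∀ n, h ∈ F n := Set.mem_iInter.1 hh.1
  refine ⟨h, (isExtreme_iInter hext).extremePoints_subset_extremePoints hh, ?_⟩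
  intro h' hh' n hn
  have key : ∀ m ≤ n, h' ∈ F m := by
    intro m
    induction m with
    | zero => exact fun _ => hh'
    | succ m ih =>
      intro hm
      refine ⟨ih (by omega), fun y hy => ?_⟩
      rw [hn m (by omega)]
      exact (hmem (m + 1)).2 y hy
  exact (hmem (n + 1)).2 h' (key n le_rfl)

/-- A state of a unital C*-algebra. -/
structure IsAlgState {D : Type*} [Ring D] [StarRing D] [Algebra ℂ D] (f : D →ₗ[ℂ] ℂ) : Prop where
  map_one : f 1 = 1
  nonneg : ∀ x, 0 ≤ f (star x * x)

section States

universe u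

variable {D : Type u} [CStarAlgebra D] [PartialOrder D] [StarOrderedRing D]

/-- A state, as a bundled positive linear functional. -/
noncomputable def IsAlgState.toPositiveLinearMap {f : D →ₗ[ℂ] ℂ} (hf : IsAlgState f) : D →ₚ[ℂ] ℂ :=
  PositiveLinearMap.mk₀ f fun x hx => by
    obtain ⟨y, rfl⟩ := CStarAlgebra.nonneg_iff_eq_star_mul_self.1 hx
    exact hf.nonneg y

/-- The GNS construction for a state. -/
theorem IsAlgState.exists_gns {f : D →ₗ[ℂ] ℂ} (hf : IsAlgState f) :
    ∃ (E : Type u) (_ : NormedAddCommGroup E) (_ : InnerProductSpace ℂ E) (_ : CompleteSpace E)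
      (ρ : D →⋆ₐ[ℂ] (E →L[ℂ] E)) (Ω : E),
      (∀ x, f x = ⟪Ω, ρ x Ω⟫_ℂ) ∧ DenseRange fun x => ρ x Ω := by
  let g := hf.toPositiveLinearMap
  refine ⟨g.GNS, inferInstance, inferInstance, inferInstance, g.gnsStarAlgHom,
    ((g.toPreGNS 1 : g.PreGNS) : g.GNS), ?_, ?_⟩
  · intro x
    have : g x = f x := rfl
    simp [PositiveLinearMap.preGNS_inner_def, this]
  · have : (fun x => g.gnsStarAlgHom x ((g.toPreGNS 1 : g.PreGNS) : g.GNS))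
        = (fun y : g.PreGNS => (y : g.GNS)) ∘ g.toPreGNS := by
      ext x
      simp
    rw [this]
    exact UniformSpace.Completion.denseRange_coe.comp g.toPreGNS.surjective.denseRange
      (UniformSpace.Completion.continuous_coe _)

theorem IsAlgState.norm_apply_le {f : D →ₗ[ℂ] ℂ} (hf : IsAlgState f) (x : D) : ‖f x‖ ≤ ‖x‖ := by
  obtain ⟨E, _, _, _, ρ, Ω, hρ, -⟩ := hf.exists_gns
  have hΩ : ‖Ω‖ = 1 := by
    have := hρ 1
    rw [hf.map_one, _root_.map_one, one_apply_eq_self, inner_self_eq_norm_sq_to_K] at this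
    have h2 : ‖Ω‖ ^ 2 = 1 := by
      apply Complex.ofReal_injective
      simpa using this.symm
    nlinarith [norm_nonneg Ω]
  rw [hρ]
  calc ‖⟪Ω, ρ x Ω⟫_ℂ‖ ≤ ‖Ω‖ * ‖ρ x Ω‖ := norm_inner_le_norm _ _
    _ ≤ ‖Ω‖ * (‖ρ x‖ * ‖Ω‖) := by gcongr; exact (ρ x).le_opNorm Ω
    _ = ‖ρ x‖ := by simp [hΩ]
    _ ≤ ‖x‖ := NonUnitalStarAlgHom.norm_apply_le ρ x

/-- The norm of a positive element is attained by a state. -/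
theorem exists_state_eq_norm [Nontrivial D] {Y : D} (hY : 0 ≤ Y) :
    ∃ f : D →ₗ[ℂ] ℂ, IsAlgState f ∧ f Y = ‖Y‖ := by
  let Z : selfAdjoint D := ⟨algebraMap ℝ D ‖Y‖ - Y,
    (IsSelfAdjoint.algebraMap D (IsSelfAdjoint.all _)).sub (IsSelfAdjoint.of_nonneg hY)⟩
  have hZ0 : 0 ≤ (Z : D) :=
    sub_nonneg.2 ((IsSelfAdjoint.of_nonneg hY).le_algebraMap_norm_self)
  have hZ : ¬ IsUnit (Z : D) :=
    spectrum.mem_iff.1 (CStarAlgebra.norm_mem_spectrum_of_nonneg hY)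
  let s : PointedCone ℝ (selfAdjoint D) :=
    { carrier := {x | ∃ t : ℝ, 0 ≤ ((x + t • Z : selfAdjoint D) : D)}
      add_mem' := by
        rintro a b ⟨t, ht⟩ ⟨u, hu⟩
        refine ⟨t + u, ?_⟩
        have := add_nonneg ht hu
        rw [← AddSubgroup.coe_add] at this
        convert this using 2
        rw [add_smul]; abel
      zero_mem' := ⟨0, by simp⟩
      smul_mem' := by
        rintro ⟨c, hc⟩ a ⟨t, ht⟩
        refine ⟨c * t, ?_⟩
        have := smul_nonneg hc ht
        rw [← selfAdjoint.val_smul] at this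
        convert this using 2
        rw [smul_add, mul_smul]; rfl }
  have hs : ∀ x : selfAdjoint D, x ∈ s ↔ ∃ t : ℝ, 0 ≤ ((x + t • Z : selfAdjoint D) : D) :=
    fun x => Iff.rfl
  let f₀ : selfAdjoint D →ₗ.[ℝ] ℝ := LinearPMap.mkSpanSingleton (1 : selfAdjoint D) (1 : ℝ)
    fun h => one_ne_zero (α := D) (congrArg Subtype.val h)
  have hnonneg : ∀ x : f₀.domain, (x : selfAdjoint D) ∈ s → 0 ≤ f₀ x := by
    rintro ⟨x, hx⟩ hxs
    obtain ⟨c, rfl⟩ := Submodule.mem_span_singleton.1 hx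
    have hval : f₀ ⟨c • 1, hx⟩ = c • (1 : ℝ) := LinearPMap.mkSpanSingleton'_apply _ _ _ _ _
    rw [hval, smul_eq_mul, mul_one]
    by_contra! hc
    obtain ⟨t, ht⟩ := (hs _).1 hxs
    apply hZ
    have h1 : (-c) • (1 : D) ≤ t • (Z : D) := by
      rw [← sub_nonneg]
      convert ht using 1
      simp; abel
    have h2 : IsUnit ((-c) • (1 : D)) := by
      rw [← Algebra.algebraMap_eq_smul_one]
      exact (IsUnit.mk0 _ (by linarith : -c ≠ 0)).map (algebraMap ℝ D)
    have h3 : IsUnit (t • (Z : D)) := CStarAlgebra.isUnit_of_le _ h1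
      ⟨smul_nonneg (by linarith) zero_le_one, h2⟩
    have h4 : t ≠ 0 := by
      rintro rfl
      rw [zero_smul] at h3
      exact not_isUnit_zero h3
    have h5 : (Z : D) = (algebraMap ℝ D t⁻¹) * (t • (Z : D)) := by
      rw [← Algebra.smul_def, smul_smul, inv_mul_cancel₀ h4, one_smul]
    rw [h5]
    exact ((IsUnit.mk0 _ (inv_ne_zero h4)).map (algebraMap ℝ D)).mul h3
  have hdense : ∀ y : selfAdjoint D, ∃ x : f₀.domain, (x : selfAdjoint D) + y ∈ s := by
    intro y
    refine ⟨⟨‖(y : D)‖ • 1, Submodule.smul_mem _ _ (Submodule.mem_span_singleton_self _)⟩, ?_⟩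
    refine (hs _).2 ⟨0, ?_⟩
    have := (y.2 : IsSelfAdjoint (y : D)).neg_algebraMap_norm_le_self
    rw [neg_le_iff_add_nonneg, Algebra.algebraMap_eq_smul_one] at this
    simpa [add_comm] using this
  obtain ⟨g, hg1, hg2⟩ := riesz_extension s f₀ hnonneg hdense
  have hgone : g 1 = 1 := by
    have := hg1 ⟨1, Submodule.mem_span_singleton_self _⟩
    rw [this]
    exact LinearPMap.mkSpanSingleton'_apply_self _ _ _ _
  have hgpos : ∀ x : selfAdjoint D, 0 ≤ (x : D) → 0 ≤ g x := fun x hx =>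
    hg2 x ((hs x).2 ⟨0, by simpa using hx⟩)
  have hgZ : g Z = 0 := by
    apply le_antisymm
    · have := hg2 (-Z) ((hs _).2 ⟨1, by simp⟩)
      simpa using this
    · exact hgpos Z hZ0
  let F : D →ₗ[ℂ] ℂ := Module.Dual.extendRCLike (𝕜 := ℂ) (g ∘ₗ realPart)
  have hF : ∀ x : selfAdjoint D, F (x : D) = g x := by
    intro x
    have h1 : realPart (x : D) = x := Subtype.ext (x.2.coe_realPart)
    have h2 : realPart (Complex.I • (x : D)) = 0 := by
      rw [realPart_I_smul, x.2.imaginaryPart, neg_zero]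
    simp [F, Module.Dual.extendRCLike_apply, h1, h2]
  refine ⟨F, ⟨?_, ?_⟩, ?_⟩
  · have := hF 1
    simpa [hgone] using this
  · intro x
    have h0 : 0 ≤ star x * x := star_mul_self_nonneg x
    have := hF ⟨star x * x, IsSelfAdjoint.of_nonneg h0⟩
    simp only at this
    rw [this]
    exact_mod_cast hgpos ⟨star x * x, _⟩ h0
  · have h1 := hF ⟨Y, IsSelfAdjoint.of_nonneg hY⟩
    simp only at h1
    rw [h1]
    have h2 : (⟨Y, IsSelfAdjoint.of_nonneg hY⟩ : selfAdjoint D) = ‖Y‖ • 1 - Z := by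
      ext
      simp [Z, Algebra.algebraMap_eq_smul_one]
    rw [h2, map_sub, map_smul, hgone, hgZ]
    simp

/-- The set of states, as functions, is compact for the topology of pointwise convergence. -/
theorem isCompact_states :
    IsCompact {h : D → ℂ | ∃ f : D →ₗ[ℂ] ℂ, IsAlgState f ∧ ⇑f = h} := by
  have hbig : IsCompact (Set.pi Set.univ fun x : D => Metric.closedBall (0 : ℂ) ‖x‖) :=
    isCompact_univ_pi fun x => isCompact_closedBall _ _
  have heq : {h : D → ℂ | ∃ f : D →ₗ[ℂ] ℂ, IsAlgState f ∧ ⇑f = h}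
      = {h : D → ℂ | (∀ x y, h (x + y) = h x + h y) ∧ (∀ (c : ℂ) x, h (c • x) = c * h x) ∧
          h 1 = 1 ∧ ∀ x, h (star x * x) ∈ Set.Ici (0 : ℂ)} := by
    ext h
    constructor
    · rintro ⟨f, hf, rfl⟩
      exact ⟨map_add f, fun c x => map_smul f c x, hf.map_one, hf.nonneg⟩
    · rintro ⟨h1, h2, h3, h4⟩
      exact ⟨{ toFun := h, map_add' := h1, map_smul' := h2 }, ⟨h3, h4⟩, rfl⟩
  refine hbig.of_isClosed_subset ?_ ?_
  · rw [heq]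
    simp only [Set.ofPred_and, Set.ofPred_forall]
    refine (isClosed_iInter fun x => isClosed_iInter fun y => ?_).inter
      ((isClosed_iInter fun c => isClosed_iInter fun x => ?_).inter
        (IsClosed.inter ?_ (isClosed_iInter fun x => ?_)))
    · exact isClosed_eq (by fun_prop) (by fun_prop)
    · exact isClosed_eq (by fun_prop) (by fun_prop)
    · exact isClosed_eq (by fun_prop) (by fun_prop)
    · exact isClosed_Ici.preimage (continuous_apply _)
  · rintro _ ⟨f, hf, rfl⟩ x -
    simpa using hf.norm_apply_le x

/-- There is a pure state attaining the norm of a positive element, and which among the states with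
this property is lexicographically maximal on a given sequence of elements. -/
theorem exists_extreme_state_lexMax [Nontrivial D] {Y : D} (hY : 0 ≤ Y) (d : ℕ → D) :
    ∃ f : D →ₗ[ℂ] ℂ, IsAlgState f ∧ f Y = ‖Y‖ ∧
      (∀ (f₁ f₂ : D →ₗ[ℂ] ℂ) (c : ℝ), IsAlgState f₁ → IsAlgState f₂ → 0 < c → c < 1 →
        (∀ x, f x = c * f₁ x + (1 - c) * f₂ x) → f₁ = f) ∧
      ∀ f' : D →ₗ[ℂ] ℂ, IsAlgState f' → f' Y = ‖Y‖ →
        ∀ n, (∀ i < n, (f' (d i)).re = (f (d i)).re) → (f' (d n)).re ≤ (f (d n)).re := by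
  let e : D → ((D → ℂ) →L[ℝ] ℝ) := fun x => Complex.reCLM ∘L ContinuousLinearMap.proj x
  have he : ∀ x (h : D → ℂ), e x h = (h x).re := fun x h => rfl
  obtain ⟨f₀, hf₀, hf₀Y⟩ := exists_state_eq_norm hY
  obtain ⟨h, hh, hmax⟩ := exists_extremePoint_lexMax (isCompact_states (D := D))
    ⟨f₀, f₀, hf₀, rfl⟩ (fun n => Nat.casesOn n (e Y) fun n => e (d n))
  rw [mem_extremePoints] at hh
  obtain ⟨⟨f, hf, rfl⟩, hext⟩ := hh
  have hre : ∀ g : D →ₗ[ℂ] ℂ, IsAlgState g → ((g Y).re : ℂ) = g Y := by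
    intro g hg
    obtain ⟨y, rfl⟩ := CStarAlgebra.nonneg_iff_eq_star_mul_self.1 hY
    exact (Complex.eq_re_of_ofReal_le (hg.nonneg y)).symm
  have hfY : f Y = ‖Y‖ := by
    rw [← hre f hf]
    congr 1
    apply le_antisymm
    · exact (Complex.re_le_norm _).trans (hf.norm_apply_le Y)
    · have := hmax _ ⟨f₀, hf₀, rfl⟩ 0 (by simp)
      simpa [he, hf₀Y] using this
  refine ⟨f, hf, hfY, ?_, ?_⟩
  · intro f₁ f₂ c hf₁ hf₂ hc0 hc1 hc
    have := (hext f₁ ⟨f₁, hf₁, rfl⟩ f₂ ⟨f₂, hf₂, rfl⟩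
      ⟨c, 1 - c, hc0, by linarith, by ring, ?_⟩).1
    · exact DFunLike.coe_injective this
    · ext x
      simp [hc x]
  · intro f' hf' hf'Y n hn
    have := hmax f' ⟨f', hf', rfl⟩ (n + 1) ?_
    · simpa [he] using this
    · intro i hi
      cases i with
      | zero => simp [he, hf'Y, hfY]
      | succ i => simpa [he] using hn i (by omega)

end States

section SmallHilbert

variable {E : Type*} [NormedAddCommGroup E] [InnerProductSpace ℂ E] [CompleteSpace E]

/-- A separable Hilbert space is isometrically isomorphic to one living in the lowest universe. -/
theorem exists_linearIsometryEquiv_small [TopologicalSpace.SeparableSpace E] :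
    ∃ (H : Type) (_ : NormedAddCommGroup H) (_ : InnerProductSpace ℂ H) (_ : CompleteSpace H),
      Nonempty (H ≃ₗᵢ[ℂ] E) := by
  obtain ⟨w, b, hb⟩ := exists_hilbertBasis ℂ E
  have hdist : ∀ x ∈ w, ∀ y ∈ w, x ≠ y → 1 ≤ dist x y := by
    intro x hx y hy hxy
    have h1 : ‖x‖ = 1 := by simpa [hb] using b.orthonormal.1 ⟨x, hx⟩
    have h2 : ‖y‖ = 1 := by simpa [hb] using b.orthonormal.1 ⟨y, hy⟩
    have h3 : ⟪x, y⟫_ℂ = 0 := by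
      simpa [hb] using b.orthonormal.2 (i := ⟨x, hx⟩) (j := ⟨y, hy⟩) (by simpa using hxy)
    have h4 := norm_sub_mul_self (𝕜 := ℂ) x y
    rw [h3, h1, h2] at h4
    rw [dist_eq_norm]
    simp only [map_zero] at h4
    nlinarith [norm_nonneg (x - y)]
  have hcount : w.Countable := by
    refine Set.PairwiseDisjoint.countable_of_isOpen (s := fun x : E => Metric.ball x (1 / 2)) ?_
      (fun _ _ => Metric.isOpen_ball) (fun x _ => ⟨x, Metric.mem_ball_self (by norm_num)⟩)
    intro x hx y hy hxy
    exact Metric.ball_disjoint_ball (by linarith [hdist x hx y hy hxy])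
  have : Countable w := hcount
  let v : Shrink.{0} w → E := fun i => b ((equivShrink.{0} w).symm i)
  have hv : Orthonormal ℂ v := b.orthonormal.comp _ (equivShrink.{0} w).symm.injective
  have hr : Set.range v = Set.range b := (equivShrink.{0} w).symm.surjective.range_comp b
  let c : HilbertBasis (Shrink.{0} w) ℂ E :=
    HilbertBasis.mk hv (by rw [hr, b.dense_span])
  exact ⟨_, inferInstance, inferInstance, inferInstance, ⟨c.repr.symm⟩⟩

/-- The range of a projection on a separable Hilbert space, as a Hilbert space in the lowest
universe. -/
theorem exists_small_corner [TopologicalSpace.SeparableSpace E] {P : E →L[ℂ] E}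
    (hP : IsSelfAdjoint P) (hPP : P * P = P) :
    ∃ (H : Type) (_ : NormedAddCommGroup H) (_ : InnerProductSpace ℂ H) (_ : CompleteSpace H)
      (V : H →L[ℂ] E), V.adjoint ∘L V = 1 ∧ V ∘L V.adjoint = P := by
  let K : Submodule ℂ E := LinearMap.ker ((1 - P : E →L[ℂ] E) : E →ₗ[ℂ] E)
  have hK : ∀ x, x ∈ K ↔ P x = x := fun x => by
    rw [show x ∈ K ↔ x - P x = 0 by simp [K], sub_eq_zero, eq_comm]
  have hPK : ∀ x, P x ∈ K := fun x => (hK _).2 (DFunLike.congr_fun hPP x)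
  have : CompleteSpace K := ((1 - P).isClosed_ker).completeSpace_coe
  obtain ⟨H, _, _, _, ⟨U⟩⟩ := exists_linearIsometryEquiv_small (E := K)
  let V : H →L[ℂ] E := K.subtypeL ∘L (U : H →L[ℂ] K)
  let W : E →L[ℂ] H := (U.symm : K →L[ℂ] H) ∘L P.codRestrict K hPK
  have hWV : W = V.adjoint := by
    rw [ContinuousLinearMap.eq_adjoint_iff]
    intro x y
    have h1 : ⟪W x, y⟫_ℂ = ⟪P.codRestrict K hPK x, U y⟫_ℂ := by
      rw [← U.inner_map_map]; simp [W]
    rw [h1]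
    have h2 : P (U y : E) = U y := (hK _).1 (U y).2
    calc ⟪P x, (U y : E)⟫_ℂ = ⟪x, P (U y : E)⟫_ℂ := by
          conv_lhs => rw [← hP.adjoint_eq]
          rw [ContinuousLinearMap.adjoint_inner_left]
      _ = ⟪x, V y⟫_ℂ := by rw [h2]; rfl
  refine ⟨H, _, _, inferInstance, V, ?_, ?_⟩
  · rw [← hWV]
    ext x
    have h2 : P (U x : E) = U x := (hK _).1 (U x).2
    have : P.codRestrict K hPK (U x) = U x := Subtype.ext h2
    simp [W, V, this]
  · rw [← hWV]
    ext x
    simp [W, V]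

end SmallHilbert

section Corner

variable {n : ℕ}

/-- A matrix over a C*-algebra with a single nonzero entry. -/
def cunit {R : Type*} [Zero R] (i j : Fin n) (r : R) : CStarMatrix (Fin n) (Fin n) R :=
  CStarMatrix.ofMatrix (Matrix.single i j r)

theorem cunit_mul_same {R : Type*} [NonUnitalNonAssocSemiring R] (i j k : Fin n) (r s : R) :
    cunit i j r * cunit j k s = cunit i k (r * s) :=
  Matrix.single_mul_single_same (i := i) (j := j) (k := k) (c := r) (d := s)

theorem cunit_add {R : Type*} [AddMonoid R] (i j : Fin n) (r s : R) :
    cunit i j (r + s) = cunit i j r + cunit i j s :=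
  Matrix.single_add i j r s

theorem cunit_smul {R : Type*} [AddCommMonoid R] [Module ℂ R] (i j : Fin n) (c : ℂ) (r : R) :
    cunit i j (c • r) = c • cunit i j r :=
  (Matrix.smul_single c i j r).symm

theorem star_cunit {R : Type*} [AddMonoid R] [StarAddMonoid R] (i j : Fin n) (r : R) :
    star (cunit i j r) = cunit j i (star r) :=
  Matrix.conjTranspose_single i j r

theorem eq_sum_cunit {R : Type*} [AddCommMonoid R] (x : CStarMatrix (Fin n) (Fin n) R) :
    x = ∑ i, ∑ j, cunit i j (x i j) :=
  Matrix.matrix_eq_sum_single x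

theorem cunit_one_mul {R : Type*} [Semiring R] (i j : Fin n)
    (x : CStarMatrix (Fin n) (Fin n) R) :
    cunit i j 1 * x = ∑ k, cunit i k (x j k) := by
  have h : (Matrix.single i j (1 : R)) * CStarMatrix.ofMatrix.symm x
      = ∑ k, Matrix.single i k (x j k) := by
    ext a b
    by_cases h : a = i
    · subst h
      simp [Matrix.sum_apply, Matrix.single_apply]
    · simp [Matrix.sum_apply, h, Ne.symm h]
  exact h

variable {R : Type*} [CStarAlgebra R] [PartialOrder R] [StarOrderedRing R]
  [TopologicalSpace.SeparableSpace R]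

/-- A state on the matrix algebra over a separable C*-algebra `R` is a vector state of the
amplification of a representation of `R`, on a Hilbert space in the lowest universe, for which the
components of the vector are jointly cyclic. -/
theorem IsAlgState.exists_rep [NeZero n] {f : CStarMatrix (Fin n) (Fin n) R →ₗ[ℂ] ℂ}
    (hf : IsAlgState f) :
    ∃ (H : Type) (_ : NormedAddCommGroup H) (_ : InnerProductSpace ℂ H) (_ : CompleteSpace H)
      (π : R →⋆ₐ[ℂ] (H →L[ℂ] H)) (ξ : Fin n → H),
      (∀ x, f x = ∑ i, ∑ j, ⟪ξ i, π (x i j) (ξ j)⟫_ℂ) ∧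
      ∀ T : H →L[ℂ] H, (∀ r j, T (π r (ξ j)) = 0) → T = 0 := by
  obtain ⟨E, _, _, _, ρ, Ω, hρ, hΩ⟩ := hf.exists_gns
  have hsepD : TopologicalSpace.SeparableSpace (CStarMatrix (Fin n) (Fin n) R) :=
    inferInstanceAs (TopologicalSpace.SeparableSpace (Fin n → Fin n → R))
  have hρcont : Continuous ρ :=
    (LipschitzWith.of_dist_le_mul (K := 1) fun x y => by
      rw [dist_eq_norm, dist_eq_norm, ← map_sub, NNReal.coe_one, one_mul]
      exact NonUnitalStarAlgHom.norm_apply_le ρ (x - y)).continuous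
  have hcont : Continuous fun x => ρ x Ω := hρcont.clm_apply continuous_const
  have hsepE : TopologicalSpace.SeparableSpace E := hΩ.separableSpace hcont
  set P : E →L[ℂ] E := ρ (cunit 0 0 1) with hPdef
  have hP : IsSelfAdjoint P := by
    rw [IsSelfAdjoint, hPdef, ← map_star, star_cunit, star_one]
  have hPP : P * P = P := by
    rw [hPdef, ← map_mul, cunit_mul_same, one_mul]
  obtain ⟨H, _, _, _, V, hV1, hV2⟩ := exists_small_corner hP hPP
  have hVV : ∀ x, V.adjoint (V x) = x := fun x => DFunLike.congr_fun hV1 x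
  have hVP : ∀ x, V (V.adjoint x) = P x := fun x => DFunLike.congr_fun hV2 x
  have hPV : ∀ x, P (V x) = V x := fun x => by rw [← hVP, hVV]
  have hmul : ∀ a b x, ρ a (ρ b x) = ρ (a * b) x := fun a b x => by rw [map_mul]; rfl
  let π : R →⋆ₐ[ℂ] (H →L[ℂ] H) :=
    { toFun := fun r => V.adjoint ∘L ρ (cunit 0 0 r) ∘L V
      map_one' := by
        ext x
        simp only [ContinuousLinearMap.comp_apply]
        rw [← hPdef, hPV, hVV]; rfl
      map_mul' := by
        intro r s
        ext x
        change V.adjoint (ρ _ (V x)) = V.adjoint (ρ _ (V (V.adjoint (ρ _ (V x)))))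
        rw [hVP, hPdef, hmul, hmul, cunit_mul_same, cunit_mul_same, mul_one]
      map_zero' := by
        have : cunit (n := n) 0 0 (0 : R) = 0 := Matrix.single_zero _ _
        ext x
        simp [this]
      map_add' := by
        intro r s
        ext x
        simp [cunit_add]
      commutes' := by
        intro c
        ext x
        rw [Algebra.algebraMap_eq_smul_one, Algebra.algebraMap_eq_smul_one, cunit_smul, map_smul]
        simp only [ContinuousLinearMap.comp_apply, smul_apply, map_smul]
        rw [← hPdef, hPV, hVV]; rfl
      map_star' := by
        intro r
        have : cunit 0 0 (star r) = star (cunit (n := n) 0 0 r) := (star_cunit _ _ _).symm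
        change V.adjoint ∘L ρ _ ∘L V = ContinuousLinearMap.adjoint (V.adjoint ∘L ρ _ ∘L V)
        rw [ContinuousLinearMap.adjoint_comp, ContinuousLinearMap.adjoint_comp,
          ContinuousLinearMap.adjoint_adjoint, this, map_star]
        rfl }
  have hπ : ∀ r x, π r x = V.adjoint (ρ (cunit 0 0 r) (V x)) := fun r x => rfl
  let η : Fin n → E := fun j => ρ (cunit 0 j 1) Ω
  let ξ : Fin n → H := fun j => V.adjoint (η j)
  have hξ : ∀ j, V (ξ j) = η j := by
    intro j
    simp only [ξ, η]
    rw [hVP, hPdef, hmul, cunit_mul_same, one_mul]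
  have hπξ : ∀ r j, π r (ξ j) = V.adjoint (ρ (cunit 0 j r) Ω) := by
    intro r j
    rw [hπ, hξ]
    simp only [η]
    rw [hmul, cunit_mul_same, mul_one]
  refine ⟨H, _, _, inferInstance, π, ξ, ?_, ?_⟩
  · intro x
    rw [hρ]
    conv_lhs => rw [eq_sum_cunit x]
    simp only [map_sum, sum_apply, inner_sum]
    refine Finset.sum_congr rfl fun i _ => Finset.sum_congr rfl fun j _ => ?_
    rw [hπξ, ContinuousLinearMap.adjoint_inner_right, hξ]
    simp only [η]
    rw [← ContinuousLinearMap.adjoint_inner_right, ← ContinuousLinearMap.star_eq_adjoint,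
      ← map_star, star_cunit, hmul, cunit_mul_same, star_one, one_mul]
  · intro T hT
    have h1 : T ∘L V.adjoint = 0 := by
      have : (fun y => (T ∘L V.adjoint) y) = fun _ => (0 : H) := by
        refine hΩ.equalizer (T ∘L V.adjoint).continuous continuous_const ?_
        ext x
        have h3 : V.adjoint (ρ x Ω) = V.adjoint (P (ρ x Ω)) := by
          rw [← hVP, hVV]
        have h4 : P (ρ x Ω) = ∑ k, ρ (cunit 0 k (x 0 k)) Ω := by
          rw [hPdef, hmul, cunit_one_mul, map_sum, sum_apply]
        simp only [Function.comp_apply, ContinuousLinearMap.comp_apply]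
        rw [h3, h4, map_sum, map_sum]
        exact Finset.sum_eq_zero fun k _ => by rw [← hπξ, hT]
      ext y
      exact congrFun this y
    ext x
    rw [← hVV x]
    exact DFunLike.congr_fun h1 (V x)

end Corner

section CompletelyPositive

variable {H : Type*} [NormedAddCommGroup H] [InnerProductSpace ℂ H] [CompleteSpace H]

theorem star_mul_self_apply_inner {n : ℕ} (X : Matrix (Fin n) (Fin n) (H →L[ℂ] H))
    (u v : Fin n → H) :
    ∑ i, ∑ j, ⟪u i, (star X * X) i j (v j)⟫_ℂ
      = ∑ k, ⟪∑ i, X k i (u i), ∑ j, X k j (v j)⟫_ℂ := by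
  have h : ∀ i j, ⟪u i, (star X * X) i j (v j)⟫_ℂ = ∑ k, ⟪X k i (u i), X k j (v j)⟫_ℂ := by
    intro i j
    rw [Matrix.mul_apply, sum_apply, inner_sum]
    refine Finset.sum_congr rfl fun k _ => ?_
    rw [Matrix.star_apply, ContinuousLinearMap.star_eq_adjoint, mul_apply_eq_comp,
      ContinuousLinearMap.adjoint_inner_right]
  simp_rw [h, sum_inner, inner_sum]
  rw [Finset.sum_comm_cycle]

theorem MatPosOp.sum_inner_nonneg {n : ℕ} {T : Matrix (Fin n) (Fin n) (H →L[ℂ] H)}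
    (hT : MatPosOp T) (v : Fin n → H) : 0 ≤ ∑ i, ∑ j, ⟪v i, T i j (v j)⟫_ℂ := by
  obtain ⟨X, rfl⟩ := hT
  rw [star_mul_self_apply_inner]
  exact Finset.sum_nonneg fun k _ => by
    rw [inner_self_eq_norm_sq_to_K]
    simp

theorem MatPosOp.isSelfAdjoint {n : ℕ} {T : Matrix (Fin n) (Fin n) (H →L[ℂ] H)}
    (hT : MatPosOp T) : IsSelfAdjoint T := by
  obtain ⟨X, rfl⟩ := hT
  exact IsSelfAdjoint.star_mul_self X

variable {R : Type*} [Ring R] [StarRing R] [Algebra ℂ R] {χ : R →ₗ[ℂ] (H →L[ℂ] H)}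

/-- The Gram matrix of a finite sequence is mapped to a positive matrix by a completely positive
map. -/
theorem IsCstarCPmap.matPosOp_gram (hχ : IsCstarCPmap χ) {n : ℕ} (a : Fin n → R) :
    MatPosOp (Matrix.of fun i j => χ (star (a i) * a j)) := by
  cases n with
  | zero => exact ⟨0, by ext i; exact i.elim0⟩
  | succ n =>
    refine hχ _ (Matrix.of fun i j => star (a i) * a j)
      ⟨Matrix.of fun k j => if k = 0 then a j else 0, ?_⟩
    ext i j
    simp [Matrix.mul_apply, Matrix.star_apply, apply_ite star]

theorem IsCstarCPmap.map_star_eq (hχ : IsCstarCPmap χ) (a : R) : χ (star a) = star (χ a) := by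
  have h := (hχ.matPosOp_gram ![1, a]).isSelfAdjoint
  have h2 := congrFun (congrFun h 1) 0
  simpa [Matrix.star_apply] using h2.symm

theorem IsCstarCPmap.sum_gram_nonneg (hχ : IsCstarCPmap χ) {n : ℕ} (a : Fin n → R)
    (v : Fin n → H) : 0 ≤ ∑ i, ∑ j, ⟪v i, χ (star (a i) * a j) (v j)⟫_ℂ :=
  (hχ.matPosOp_gram a).sum_inner_nonneg v

theorem IsCstarCPmap.inner_map_star (hχ : IsCstarCPmap χ) (a : R) (x y : H) :
    ⟪x, χ (star a) y⟫_ℂ = ⟪χ a x, y⟫_ℂ := by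
  rw [hχ.map_star_eq, ContinuousLinearMap.star_eq_adjoint,
    ContinuousLinearMap.adjoint_inner_right]

theorem IsCstarCPmap.inner_map_star_left (hχ : IsCstarCPmap χ) (a : R) (x y : H) :
    ⟪χ (star a) x, y⟫_ℂ = ⟪x, χ a y⟫_ℂ := by
  rw [hχ.map_star_eq, ContinuousLinearMap.star_eq_adjoint,
    ContinuousLinearMap.adjoint_inner_left]

/-- The Kadison–Schwarz inequality for rows. -/
theorem IsCstarCPmap.norm_sq_sum_le (hχ : IsCstarCPmap χ) (hone : χ 1 = 1) {n : ℕ}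
    (a : Fin n → R) (v : Fin n → H) :
    ((‖∑ j, χ (a j) (v j)‖ ^ 2 : ℝ) : ℂ) ≤ ∑ i, ∑ j, ⟪v i, χ (star (a i) * a j) (v j)⟫_ℂ := by
  set s := ∑ j, χ (a j) (v j) with hs
  have h := hχ.sum_gram_nonneg (Fin.cons 1 a : Fin (n + 1) → R) (Fin.cons (-s) v)
  simp only [Fin.sum_univ_succ, Fin.cons_zero, Fin.cons_succ, star_one, one_mul, mul_one, hone,
    one_apply_eq_self, hχ.inner_map_star, Finset.sum_add_distrib] at h
  rw [← inner_sum, ← sum_inner, ← hs] at h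
  simp only [inner_neg_left, inner_neg_right, inner_self_eq_norm_sq_to_K, norm_neg] at h
  rw [← sub_nonneg]
  convert h using 1
  push_cast
  simp only [Complex.coe_algebraMap]
  ring

/-- Multiplicativity of a completely positive map at a vector where equality holds in the
Kadison–Schwarz inequality. -/
theorem IsCstarCPmap.map_mul_of_eq (hχ : IsCstarCPmap χ) (hone : χ 1 = 1) {w : R} {v : H}
    (h : ⟪v, χ (star w * w) v⟫_ℂ = ⟪χ w v, χ w v⟫_ℂ) (r : R) :
    χ (r * w) v = χ r (χ w v) := by
  set δ := χ (r * w) v - χ r (χ w v) with hδ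
  have key : ∀ t : ℝ, 0 ≤ 2 * t * ‖δ‖ ^ 2 + t ^ 2 * (⟪χ (r * star r) δ, δ⟫_ℂ).re := by
    intro t
    have h3 := hχ.sum_gram_nonneg ![1, w, star r] ![-(χ w v), v, (t : ℂ) • δ]
    simp only [Fin.sum_univ_three, Matrix.cons_val_zero, Matrix.cons_val_one, Matrix.cons_val,
      star_one, one_mul, mul_one, hone, one_apply_eq_self, star_star, hχ.inner_map_star,
      hχ.inner_map_star_left,
      ← star_mul, map_neg, map_smul, inner_neg_left, inner_neg_right, inner_smul_left,
      inner_smul_right, h, Complex.conj_ofReal] at h3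
    have h4 : ⟪δ, χ (r * w) v⟫_ℂ - ⟪δ, χ r (χ w v)⟫_ℂ = ⟪δ, δ⟫_ℂ := by
      rw [← inner_sub_right]
    have h5 : ⟪χ (r * w) v, δ⟫_ℂ - ⟪χ r (χ w v), δ⟫_ℂ = ⟪δ, δ⟫_ℂ := by
      rw [← inner_sub_left]
    have h6 : ⟪δ, δ⟫_ℂ = ((‖δ‖ ^ 2 : ℝ) : ℂ) := by
      rw [inner_self_eq_norm_sq_to_K]; norm_cast
    have h7 := (Complex.le_def.1 h3).1
    have h8 := congrArg Complex.re (h4.trans h6)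
    have h9 := congrArg Complex.re (h5.trans h6)
    simp only [Complex.add_re, Complex.sub_re, Complex.neg_re, Complex.ofReal_re, Complex.zero_re,
      Complex.re_ofReal_mul] at h7 h8 h9
    exact h7.trans_eq (by linear_combination t * h8 + t * h9)
  have hδ0 : ‖δ‖ ^ 2 = 0 := by
    by_contra hne
    have hpos : 0 < ‖δ‖ ^ 2 := lt_of_le_of_ne (sq_nonneg _) (Ne.symm hne)
    set C := (⟪χ (r * star r) δ, δ⟫_ℂ).re
    have h1 := key (-(‖δ‖ ^ 2) / (|C| + 1))
    have hC : 0 < |C| + 1 := by positivity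
    have h2 : 2 * (-(‖δ‖ ^ 2) / (|C| + 1)) * ‖δ‖ ^ 2 + (-(‖δ‖ ^ 2) / (|C| + 1)) ^ 2 * C
        = (‖δ‖ ^ 2) ^ 2 * (C - 2 * (|C| + 1)) / (|C| + 1) ^ 2 := by
      field_simp
      ring
    rw [h2] at h1
    have h3 : (‖δ‖ ^ 2) ^ 2 * (C - 2 * (|C| + 1)) / (|C| + 1) ^ 2 < 0 := by
      apply div_neg_of_neg_of_pos _ (by positivity)
      apply mul_neg_of_pos_of_neg (by positivity)
      linarith [le_abs_self C, abs_nonneg C]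
    linarith
  have : δ = 0 := by simpa using hδ0
  exact sub_eq_zero.1 this

end CompletelyPositive

section VectorStates

variable {H : Type*} [NormedAddCommGroup H] [InnerProductSpace ℂ H]
  {R : Type*} [Ring R] [Algebra ℂ R] {n : ℕ}

/-- The functional on matrices induced by a linear map into operators and a tuple of vectors. -/
noncomputable def cform (χ : R →ₗ[ℂ] (H →L[ℂ] H)) (v : Fin n → H) :
    CStarMatrix (Fin n) (Fin n) R →ₗ[ℂ] ℂ where
  toFun x := ∑ i, ∑ j, ⟪v i, χ (x i j) (v j)⟫_ℂ
  map_add' x y := by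
    simp [Finset.sum_add_distrib]
  map_smul' c x := by
    simp [Finset.mul_sum]

theorem cform_apply (χ : R →ₗ[ℂ] (H →L[ℂ] H)) (v : Fin n → H)
    (x : CStarMatrix (Fin n) (Fin n) R) :
    cform χ v x = ∑ i, ∑ j, ⟪v i, χ (x i j) (v j)⟫_ℂ := rfl

theorem cform_one {χ : R →ₗ[ℂ] (H →L[ℂ] H)} (hone : χ 1 = 1) (v : Fin n → H) :
    cform χ v 1 = ∑ i, ⟪v i, v i⟫_ℂ := by
  rw [cform_apply]
  refine Finset.sum_congr rfl fun i _ => ?_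
  rw [Finset.sum_eq_single i]
  · simp [hone]
  · intro j _ hj
    simp [CStarMatrix.one_apply_ne' hj]
  · simp

theorem IsCstarCPmap.isAlgState_cform [StarRing R] [CompleteSpace H] {χ : R →ₗ[ℂ] (H →L[ℂ] H)}
    (hχ : IsCstarCPmap χ) (hone : χ 1 = 1) {v : Fin n → H} (hv : ∑ i, ⟪v i, v i⟫_ℂ = 1) :
    IsAlgState (cform χ v) where
  map_one := by rw [cform_one hone, hv]
  nonneg x := (hχ n _ ⟨CStarMatrix.ofMatrix.symm x, rfl⟩).sum_inner_nonneg v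

end VectorStates

section Irreducible

variable {H : Type*} [NormedAddCommGroup H] [InnerProductSpace ℂ H] [CompleteSpace H]
  {R : Type*} [Ring R] [StarRing R] [Algebra ℂ R] {n : ℕ}

theorem eq_zero_of_inner_cyclic {π : R →⋆ₐ[ℂ] (H →L[ℂ] H)} {ξ : Fin n → H}
    (hcyc : ∀ T : H →L[ℂ] H, (∀ r j, T (π r (ξ j)) = 0) → T = 0) {y : H}
    (hy : ∀ r j, ⟪y, π r (ξ j)⟫_ℂ = 0) : y = 0 := by
  have h := hcyc ((innerSL ℂ y).smulRight y) fun r j => by simp [hy]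
  have h2 := DFunLike.congr_fun h y
  simpa using h2

/-- The functional obtained by compressing a vector functional by an operator in the commutant. -/
noncomputable def commForm (π : R →⋆ₐ[ℂ] (H →L[ℂ] H)) (ξ : Fin n → H) (A : H →L[ℂ] H) :
    CStarMatrix (Fin n) (Fin n) R →ₗ[ℂ] ℂ :=
  cform (LinearMap.mulLeft ℂ A ∘ₗ (π : R →ₗ[ℂ] (H →L[ℂ] H))) ξ

theorem commForm_apply (π : R →⋆ₐ[ℂ] (H →L[ℂ] H)) (ξ : Fin n → H) (A : H →L[ℂ] H)
    (x : CStarMatrix (Fin n) (Fin n) R) :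
    commForm π ξ A x = ∑ i, ∑ j, ⟪ξ i, A (π (x i j) (ξ j))⟫_ℂ := rfl

theorem commForm_one (π : R →⋆ₐ[ℂ] (H →L[ℂ] H)) (ξ : Fin n → H) (A : H →L[ℂ] H) :
    commForm π ξ A 1 = ∑ i, ⟪ξ i, A (ξ i)⟫_ℂ := by
  rw [commForm_apply]
  refine Finset.sum_congr rfl fun i _ => ?_
  rw [Finset.sum_eq_single i]
  · simp
  · intro j _ hj
    simp [CStarMatrix.one_apply_ne' hj]
  · simp

theorem commForm_nonneg (π : R →⋆ₐ[ℂ] (H →L[ℂ] H)) (ξ : Fin n → H) {A : H →L[ℂ] H}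
    (hA : ∀ r, A * π r = π r * A) (hpos : ∀ x, 0 ≤ ⟪x, A x⟫_ℂ)
    (x : CStarMatrix (Fin n) (Fin n) R) : 0 ≤ commForm π ξ A (star x * x) := by
  have h1 : ∀ i j, π ((star x * x) i j)
      = (star ((CStarMatrix.ofMatrix.symm x).map π) * (CStarMatrix.ofMatrix.symm x).map π) i j := by
    intro i j
    rw [CStarMatrix.mul_apply, Matrix.mul_apply, map_sum]
    refine Finset.sum_congr rfl fun k _ => ?_
    rw [CStarMatrix.star_apply, map_mul, map_star]
    rfl
  have hA' : ∀ r y, A (π r y) = π r (A y) := fun r y => DFunLike.congr_fun (hA r) y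
  rw [commForm_apply]
  simp_rw [hA', h1]
  rw [star_mul_self_apply_inner _ ξ (fun j => A (ξ j))]
  refine Finset.sum_nonneg fun k _ => ?_
  have h2 : ∑ j, (CStarMatrix.ofMatrix.symm x).map π k j (A (ξ j))
      = A (∑ j, (CStarMatrix.ofMatrix.symm x).map π k j (ξ j)) := by
    rw [map_sum]
    exact Finset.sum_congr rfl fun j _ => (hA' _ _).symm
  rw [h2]
  exact hpos _

theorem isAlgState_commForm (π : R →⋆ₐ[ℂ] (H →L[ℂ] H)) (ξ : Fin n → H) {A : H →L[ℂ] H}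
    (hA : ∀ r, A * π r = π r * A) (hpos : ∀ x, 0 ≤ ⟪x, A x⟫_ℂ) {c : ℝ} (hc : 0 < c)
    (hcA : commForm π ξ A 1 = c) : IsAlgState (((c⁻¹ : ℝ) : ℂ) • commForm π ξ A) where
  map_one := by
    rw [LinearMap.smul_apply, hcA, smul_eq_mul, ← Complex.ofReal_mul, inv_mul_cancel₀ hc.ne',
      Complex.ofReal_one]
  nonneg x := by
    rw [LinearMap.smul_apply, smul_eq_mul]
    exact mul_nonneg (Complex.zero_le_real.2 (inv_nonneg.2 hc.le)) (commForm_nonneg π ξ hA hpos x)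

/-- The representation attached to a pure state on matrices is irreducible. -/
theorem hasTrivialCommutant_of_extreme {f : CStarMatrix (Fin n) (Fin n) R →ₗ[ℂ] ℂ}
    (hf : IsAlgState f)
    (hext : ∀ (f₁ f₂ : CStarMatrix (Fin n) (Fin n) R →ₗ[ℂ] ℂ) (c : ℝ),
      IsAlgState f₁ → IsAlgState f₂ → 0 < c → c < 1 →
      (∀ x, f x = c * f₁ x + (1 - c) * f₂ x) → f₁ = f)
    {π : R →⋆ₐ[ℂ] (H →L[ℂ] H)} {ξ : Fin n → H}
    (hfξ : ∀ x, f x = ∑ i, ∑ j, ⟪ξ i, π (x i j) (ξ j)⟫_ℂ)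
    (hcyc : ∀ T : H →L[ℂ] H, (∀ r j, T (π r (ξ j)) = 0) → T = 0) :
    HasTrivialCommutant ⇑π := by
  have hξ : ∑ i, ⟪ξ i, ξ i⟫_ℂ = 1 := by
    rw [← hf.map_one, hfξ]
    exact (cform_one (χ := (π : R →ₗ[ℂ] (H →L[ℂ] H))) (by simp) ξ).symm
  have hξ' : ∑ i, ‖ξ i‖ ^ 2 = 1 := by
    have := congrArg Complex.re hξ
    simpa [inner_self_eq_norm_sq_to_K, ← Complex.ofReal_pow] using this
  have main : ∀ A : H →L[ℂ] H, IsSelfAdjoint A → (∀ r, A * π r = π r * A) →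
      (∀ x, (1 / 4) * ‖x‖ ^ 2 ≤ (⟪x, A x⟫_ℂ).re) → (∀ x, (⟪x, A x⟫_ℂ).re ≤ (3 / 4) * ‖x‖ ^ 2) →
      ∃ c : ℂ, A = c • (1 : H →L[ℂ] H) := by
    intro A hA hcomm hlow hupp
    have hreal : ∀ x, ⟪x, A x⟫_ℂ = ((⟪x, A x⟫_ℂ).re : ℂ) := by
      intro x
      have h1 : ⟪A x, x⟫_ℂ = ⟪x, A x⟫_ℂ := by
        conv_lhs => rw [← hA.adjoint_eq]
        rw [ContinuousLinearMap.adjoint_inner_left]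
      rw [eq_comm, ← Complex.conj_eq_iff_re, inner_conj_symm, h1]
    have hself : ∀ x : H, ⟪x, x⟫_ℂ = ((‖x‖ ^ 2 : ℝ) : ℂ) := by
      intro x
      rw [inner_self_eq_norm_sq_to_K]
      norm_cast
    set c : ℝ := ∑ i, (⟪ξ i, A (ξ i)⟫_ℂ).re with hc
    have hc1 : commForm π ξ A 1 = c := by
      rw [commForm_one, hc, Complex.ofReal_sum]
      exact Finset.sum_congr rfl fun i _ => hreal _
    have hclow : 1 / 4 ≤ c := by
      rw [show (1 / 4 : ℝ) = 1 / 4 * ∑ i, ‖ξ i‖ ^ 2 by rw [hξ', mul_one], Finset.mul_sum]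
      exact Finset.sum_le_sum fun i _ => hlow _
    have hcupp : c ≤ 3 / 4 := by
      rw [show (3 / 4 : ℝ) = 3 / 4 * ∑ i, ‖ξ i‖ ^ 2 by rw [hξ', mul_one], Finset.mul_sum]
      exact Finset.sum_le_sum fun i _ => hupp _
    have hf' : f = commForm π ξ 1 := LinearMap.ext fun x => hfξ x
    have hadd : ∀ (B C : H →L[ℂ] H) x,
        commForm π ξ (B - C) x = commForm π ξ B x - commForm π ξ C x := by
      intro B C x
      simp [commForm_apply]
    have hc2 : commForm π ξ (1 - A) 1 = ((1 - c : ℝ) : ℂ) := by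
      rw [hadd, hc1, ← hf', hf.map_one]
      norm_cast
    have hst1 := isAlgState_commForm π ξ hcomm
      (fun x => by
        rw [hreal]
        exact Complex.zero_le_real.2 (le_trans (by positivity) (hlow x)))
      (by linarith) hc1
    have hst2 := isAlgState_commForm π ξ (A := 1 - A)
      (fun r => by rw [sub_mul, mul_sub, hcomm, one_mul, mul_one])
      (fun x => by
        rw [sub_apply, inner_sub_right, one_apply_eq_self, hreal, hself, ← Complex.ofReal_sub]
        refine Complex.zero_le_real.2 ?_
        nlinarith [hupp x, sq_nonneg ‖x‖])
      (by linarith) hc2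
    have heq := hext _ _ c hst1 hst2 (by linarith) (by linarith) fun x => by
      have hcne : (c : ℂ) ≠ 0 := by exact_mod_cast (by linarith : c ≠ 0)
      have hcne' : (1 - c : ℂ) ≠ 0 := by
        rw [← Complex.ofReal_one, ← Complex.ofReal_sub]
        exact_mod_cast (by linarith : (1 - c : ℝ) ≠ 0)
      rw [LinearMap.smul_apply, LinearMap.smul_apply, hadd, hf', smul_eq_mul, smul_eq_mul]
      push_cast
      field_simp
      ring
    refine ⟨c, ?_⟩
    have hzero : ∀ x, commForm π ξ (A - (c : ℂ) • 1) x = 0 := by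
      intro x
      have h1 := DFunLike.congr_fun heq x
      rw [LinearMap.smul_apply, hf', smul_eq_mul] at h1
      have hcne : (c : ℂ) ≠ 0 := by exact_mod_cast (by linarith : c ≠ 0)
      have h2 : commForm π ξ ((c : ℂ) • 1) x = c * commForm π ξ 1 x := by
        simp only [commForm_apply, smul_apply, inner_smul_right, Finset.mul_sum]
      rw [hadd, h2, ← h1]
      push_cast
      field_simp
      ring
    rw [← sub_eq_zero]
    refine hcyc _ fun s j => ?_
    have hcomm' : ∀ r y, (A - (c : ℂ) • (1 : H →L[ℂ] H)) (π r y)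
        = π r ((A - (c : ℂ) • (1 : H →L[ℂ] H)) y) := by
      intro r y
      have := DFunLike.congr_fun (hcomm r) y
      simp only [mul_apply_eq_comp] at this
      simp [this]
    refine eq_zero_of_inner_cyclic hcyc fun r i => ?_
    rw [← inner_conj_symm]
    have h3 := hzero (cunit i j (star r * s))
    rw [commForm_apply, Finset.sum_eq_single i, Finset.sum_eq_single j] at h3
    · have h4 : cunit i j (star r * s) i j = star r * s := Matrix.single_apply_same _ _ _
      rw [h4, map_mul, map_star, mul_apply_eq_comp, ContinuousLinearMap.star_eq_adjoint] at h3
      have h5 : ∀ y, (A - (c : ℂ) • (1 : H →L[ℂ] H)) (ContinuousLinearMap.adjoint (π r) y)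
          = ContinuousLinearMap.adjoint (π r) ((A - (c : ℂ) • (1 : H →L[ℂ] H)) y) := by
        intro y
        rw [← ContinuousLinearMap.star_eq_adjoint, ← map_star, hcomm']
      rw [h5, ContinuousLinearMap.adjoint_inner_right] at h3
      rw [h3, map_zero]
    · intro j' _ hj'
      have h4 : cunit i j (star r * s) i j' = 0 :=
        Matrix.single_apply_of_col_ne _ _ (Ne.symm hj') _
      simp [h4]
    · simp
    · intro i' _ hi'
      have h4 : ∀ j', cunit i j (star r * s) i' j' = 0 := fun j' =>
        Matrix.single_apply_of_row_ne (Ne.symm hi') _ _ _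
      simp [h4]
    · simp
  have main2 : ∀ A : H →L[ℂ] H, IsSelfAdjoint A → (∀ r, A * π r = π r * A) →
      ∃ c : ℂ, A = c • (1 : H →L[ℂ] H) := by
    intro A hA hcomm
    set k : ℝ := (4 * (‖A‖ + 1))⁻¹ with hk
    have hk0 : 0 < k := by positivity
    have hkA : k * ‖A‖ ≤ 1 / 4 := by
      rw [hk, inv_mul_le_iff₀ (by positivity)]
      linarith
    have hbound : ∀ x, |(⟪x, A x⟫_ℂ).re| ≤ ‖A‖ * ‖x‖ ^ 2 := by
      intro x
      calc |(⟪x, A x⟫_ℂ).re| ≤ ‖⟪x, A x⟫_ℂ‖ := Complex.abs_re_le_norm _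
        _ ≤ ‖x‖ * ‖A x‖ := norm_inner_le_norm _ _
        _ ≤ ‖x‖ * (‖A‖ * ‖x‖) := by gcongr; exact A.le_opNorm x
        _ = ‖A‖ * ‖x‖ ^ 2 := by ring
    have hform : ∀ x, (⟪x, ((2⁻¹ : ℝ) : ℂ) • x + (k : ℂ) • A x⟫_ℂ).re
        = 2⁻¹ * ‖x‖ ^ 2 + k * (⟪x, A x⟫_ℂ).re := by
      intro x
      rw [inner_add_right, inner_smul_right, inner_smul_right, inner_self_eq_norm_sq_to_K,
        Complex.add_re, Complex.re_ofReal_mul, Complex.re_ofReal_mul]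
      norm_cast
    obtain ⟨c, hc⟩ := main (((2⁻¹ : ℝ) : ℂ) • 1 + (k : ℂ) • A)
      ((IsSelfAdjoint.smul (Complex.conj_ofReal _) (IsSelfAdjoint.one _)).add
        (IsSelfAdjoint.smul (Complex.conj_ofReal _) hA))
      (fun r => by
        rw [add_mul, mul_add, smul_mul_assoc, smul_mul_assoc, mul_smul_comm, mul_smul_comm,
          hcomm, one_mul, mul_one])
      (fun x => by
        have h1 := hform x
        have h2 := (abs_le.1 (hbound x)).1
        simp only [add_apply, smul_apply, one_apply_eq_self]
        rw [h1]
        nlinarith [mul_le_mul_of_nonneg_right hkA (sq_nonneg ‖x‖),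
          mul_le_mul_of_nonneg_left h2 hk0.le])
      (fun x => by
        have h1 := hform x
        have h2 := (abs_le.1 (hbound x)).2
        simp only [add_apply, smul_apply, one_apply_eq_self]
        rw [h1]
        nlinarith [mul_le_mul_of_nonneg_right hkA (sq_nonneg ‖x‖),
          mul_le_mul_of_nonneg_left h2 hk0.le])
    refine ⟨(k : ℂ)⁻¹ * (c - ((2⁻¹ : ℝ) : ℂ)), ?_⟩
    have hkne : (k : ℂ) ≠ 0 := by exact_mod_cast hk0.ne'
    rw [mul_smul, sub_smul, ← hc, add_sub_cancel_left, smul_smul, inv_mul_cancel₀ hkne, one_smul]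
  intro A hA
  have hA' : ∀ r, star A * π r = π r * star A := by
    intro r
    have := congrArg star (hA (star r))
    simpa [map_star] using this.symm
  obtain ⟨c₁, h₁⟩ := main2 (A + star A) (IsSelfAdjoint.add_star_self A) fun r => by
    rw [add_mul, mul_add, hA, hA']
  obtain ⟨c₂, h₂⟩ := main2 (Complex.I • (A - star A))
    (by
      rw [IsSelfAdjoint, star_smul, star_sub, star_star]
      simp [← smul_neg]) fun r => by
    rw [smul_mul_assoc, mul_smul_comm, sub_mul, mul_sub, hA, hA']
  refine ⟨2⁻¹ * (c₁ - Complex.I * c₂), ?_⟩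
  have h3 : A = (2⁻¹ : ℂ) • ((A + star A) - Complex.I • (Complex.I • (A - star A))) := by
    rw [smul_smul, Complex.I_mul_I]
    module
  rw [h₁, h₂] at h3
  rw [h3]
  module

end Irreducible

section MatOp

variable {H : Type*} [NormedAddCommGroup H] [InnerProductSpace ℂ H] {n : ℕ}

theorem matOp_apply (T : Matrix (Fin n) (Fin n) (H →L[ℂ] H)) (v : PiLp 2 fun _ : Fin n => H)
    (i : Fin n) : matOp T v i = ∑ j, T i j (v j) := by
  simp [matOp]

theorem norm_sq_matOp_apply (T : Matrix (Fin n) (Fin n) (H →L[ℂ] H))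
    (v : PiLp 2 fun _ : Fin n => H) : ‖matOp T v‖ ^ 2 = ∑ k, ‖∑ j, T k j (v j)‖ ^ 2 := by
  rw [PiLp.norm_sq_eq_of_L2]
  simp_rw [matOp_apply]

theorem sum_inner_self_eq (v : PiLp 2 fun _ : Fin n => H) :
    ∑ i, ⟪v i, v i⟫_ℂ = ((‖v‖ ^ 2 : ℝ) : ℂ) := by
  rw [PiLp.norm_sq_eq_of_L2, Complex.ofReal_sum]
  refine Finset.sum_congr rfl fun k _ => ?_
  rw [inner_self_eq_norm_sq_to_K]
  norm_cast

variable [CompleteSpace H] {R : Type*} [Ring R] [StarRing R] [Algebra ℂ R]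

theorem cform_star_mul_self (ρ : R →⋆ₐ[ℂ] (H →L[ℂ] H)) (v : Fin n → H)
    (M : CStarMatrix (Fin n) (Fin n) R) :
    cform (ρ : R →ₗ[ℂ] (H →L[ℂ] H)) v (star M * M)
      = ((∑ k, ‖∑ j, ρ (M k j) (v j)‖ ^ 2 : ℝ) : ℂ) := by
  have h1 : ∀ i j, ρ ((star M * M) i j)
      = (star ((CStarMatrix.ofMatrix.symm M).map ρ) * (CStarMatrix.ofMatrix.symm M).map ρ) i j := by
    intro i j
    rw [CStarMatrix.mul_apply, Matrix.mul_apply, map_sum]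
    refine Finset.sum_congr rfl fun k _ => ?_
    rw [CStarMatrix.star_apply, map_mul, map_star]
    rfl
  rw [cform_apply]
  change ∑ i, ∑ j, ⟪v i, ρ ((star M * M) i j) (v j)⟫_ℂ = _
  simp_rw [h1]
  rw [star_mul_self_apply_inner, Complex.ofReal_sum]
  refine Finset.sum_congr rfl fun k _ => ?_
  rw [inner_self_eq_norm_sq_to_K]
  norm_cast

theorem cform_star_mul_self_eq_norm_sq (ρ : R →⋆ₐ[ℂ] (H →L[ℂ] H))
    (v : PiLp 2 fun _ : Fin n => H) (M : CStarMatrix (Fin n) (Fin n) R) :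
    cform (ρ : R →ₗ[ℂ] (H →L[ℂ] H)) v (star M * M)
      = ((‖matOp ((CStarMatrix.ofMatrix.symm M).map ρ) v‖ ^ 2 : ℝ) : ℂ) := by
  rw [cform_star_mul_self, norm_sq_matOp_apply]
  rfl

end MatOp

section MatOpNorm

variable {H : Type*} [NormedAddCommGroup H] [InnerProductSpace ℂ H] [CompleteSpace H] {n : ℕ}
  {R : Type*} [CStarAlgebra R] [PartialOrder R] [StarOrderedRing R]

theorem exists_star_mul_self_add_eq {D : Type*} [CStarAlgebra D] (a : D) :
    ∃ y, star a * a + star y * y = ((‖a‖ ^ 2 : ℝ) : ℂ) • (1 : D) := by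
  let := CStarAlgebra.spectralOrder D
  have := CStarAlgebra.spectralOrderedRing D
  have h0 : 0 ≤ algebraMap ℝ D (‖a‖ ^ 2) - star a * a :=
    sub_nonneg.2 CStarAlgebra.star_mul_le_algebraMap_norm_sq
  obtain ⟨y, hy⟩ := CStarAlgebra.nonneg_iff_eq_star_mul_self.1 h0
  refine ⟨y, ?_⟩
  rw [← hy, add_sub_cancel, Algebra.algebraMap_eq_smul_one]
  exact (Complex.coe_smul _ _).symm

/-- Amplifications of representations are contractive. -/
theorem norm_matOp_map_le (ρ : R →⋆ₐ[ℂ] (H →L[ℂ] H)) (M : CStarMatrix (Fin n) (Fin n) R) :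
    ‖matOp ((CStarMatrix.ofMatrix.symm M).map ρ)‖ ≤ ‖M‖ := by
  refine ContinuousLinearMap.opNorm_le_bound _ (norm_nonneg _) fun v => ?_
  obtain ⟨y, h1⟩ := exists_star_mul_self_add_eq M
  have h2 := congrArg (cform (ρ : R →ₗ[ℂ] (H →L[ℂ] H)) v) h1
  rw [map_add, map_smul, cform_one (by simp), cform_star_mul_self_eq_norm_sq,
    cform_star_mul_self_eq_norm_sq, sum_inner_self_eq, smul_eq_mul, ← Complex.ofReal_mul,
    ← Complex.ofReal_add, Complex.ofReal_inj] at h2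
  refine (sq_le_sq₀ (norm_nonneg _) (by positivity)).1 ?_
  nlinarith [sq_nonneg ‖matOp ((CStarMatrix.ofMatrix.symm y).map ρ) v‖]

/-- The amplification of a representation is isometric at a matrix whose norm is attained by a
vector state. -/
theorem norm_matOp_map_eq (ρ : R →⋆ₐ[ℂ] (H →L[ℂ] H)) (M : CStarMatrix (Fin n) (Fin n) R)
    {v : Fin n → H} (hv : ∑ i, ⟪v i, v i⟫_ℂ = 1)
    (hM : cform (ρ : R →ₗ[ℂ] (H →L[ℂ] H)) v (star M * M) = ‖star M * M‖) :
    ‖matOp ((CStarMatrix.ofMatrix.symm M).map ρ)‖ = ‖M‖ := by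
  refine le_antisymm (norm_matOp_map_le ρ M) ?_
  let u : PiLp 2 fun _ : Fin n => H := WithLp.toLp 2 v
  have hu : ‖u‖ = 1 := by
    have h1 := sum_inner_self_eq u
    have h2 : ∑ i, ⟪u i, u i⟫_ℂ = 1 := hv
    rw [h2] at h1
    have h3 : ‖u‖ ^ 2 = 1 := by exact_mod_cast h1.symm
    nlinarith [norm_nonneg u]
  have h4 : cform (ρ : R →ₗ[ℂ] (H →L[ℂ] H)) v (star M * M)
      = ((‖matOp ((CStarMatrix.ofMatrix.symm M).map ρ) u‖ ^ 2 : ℝ) : ℂ) :=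
    cform_star_mul_self_eq_norm_sq ρ u M
  rw [hM, CStarRing.norm_star_mul_self, Complex.ofReal_inj, ← sq] at h4
  have h5 := (matOp ((CStarMatrix.ofMatrix.symm M).map ρ)).le_opNorm u
  rw [hu, mul_one] at h5
  refine le_trans (le_of_eq ?_) h5
  exact (sq_eq_sq₀ (norm_nonneg _) (norm_nonneg _)).1 h4

end MatOpNorm

section UniqueExtension

variable {H : Type*} [NormedAddCommGroup H] [InnerProductSpace ℂ H] [CompleteSpace H] {n : ℕ}
  {R : Type*} [CStarAlgebra R] [PartialOrder R] [StarOrderedRing R]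

/-- The word in the sequence `t` with a given code. -/
def codedWord {R : Type*} [Monoid R] (t : ℕ → R) (k : ℕ) : R :=
  ((Denumerable.ofNat (List ℕ) k).map t).prod

theorem codedWord_eq_one_or {R : Type*} [Monoid R] (t : ℕ → R) (k : ℕ) :
    codedWord t k = 1 ∨ ∃ a, ∃ m < k, codedWord t k = t a * codedWord t m := by
  rcases h : Denumerable.ofNat (List ℕ) k with _ | ⟨a, l⟩
  · left
    simp [codedWord, h]
  · right
    refine ⟨a, Encodable.encode l, ?_, ?_⟩
    · have hk : k = Encodable.encode (a :: l) := by rw [← h, Denumerable.encode_ofNat]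
      rw [hk, Encodable.encode_list_cons]
      exact Nat.lt_succ_of_le (Nat.right_le_pair _ _)
    · simp [codedWord, h]

/-- The diagonal matrix with constant diagonal entry. -/
def cdiag {R : Type*} [Zero R] (r : R) : CStarMatrix (Fin n) (Fin n) R :=
  CStarMatrix.ofMatrix (Matrix.diagonal fun _ => r)

theorem cform_cdiag {H : Type*} [NormedAddCommGroup H] [InnerProductSpace ℂ H] {n : ℕ}
    {R : Type*} [Ring R] [Algebra ℂ R] (χ : R →ₗ[ℂ] (H →L[ℂ] H)) (v : Fin n → H)
    (r : R) : cform χ v (cdiag r) = ∑ i, ⟪v i, χ r (v i)⟫_ℂ := by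
  rw [cform_apply]
  refine Finset.sum_congr rfl fun i _ => ?_
  rw [Finset.sum_eq_single i]
  · simp [cdiag]
  · intro j _ hj
    simp [cdiag, Matrix.diagonal_apply_ne' _ hj]
  · simp

/-- The unique extension property for the representation attached to a lexicographically maximal
norm-attaining state. -/
theorem eq_of_lexMax {t : ℕ → R}
    (ht : Dense (Submodule.span ℂ (Set.range (codedWord t)) : Set R))
    {M : CStarMatrix (Fin n) (Fin n) R} {π : R →⋆ₐ[ℂ] (H →L[ℂ] H)} {ξ : Fin n → H}
    (hξ : ∑ i, ⟪ξ i, ξ i⟫_ℂ = 1)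
    (hM : cform (π : R →ₗ[ℂ] (H →L[ℂ] H)) ξ (star M * M) = ‖star M * M‖)
    (hmax : ∀ f' : CStarMatrix (Fin n) (Fin n) R →ₗ[ℂ] ℂ, IsAlgState f' →
      f' (star M * M) = ‖star M * M‖ → ∀ k,
      (∀ i < k, (f' (cdiag (star (codedWord t i) * codedWord t i))).re
        = (cform (π : R →ₗ[ℂ] (H →L[ℂ] H)) ξ
            (cdiag (star (codedWord t i) * codedWord t i))).re) →
      (f' (cdiag (star (codedWord t k) * codedWord t k))).re
        ≤ (cform (π : R →ₗ[ℂ] (H →L[ℂ] H)) ξ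
            (cdiag (star (codedWord t k) * codedWord t k))).re)
    (hcyc : ∀ T : H →L[ℂ] H, (∀ r j, T (π r (ξ j)) = 0) → T = 0)
    {χ : R →ₗ[ℂ] (H →L[ℂ] H)} (hχ : IsCstarCPmap χ) (hone : χ 1 = 1)
    (hbound : ∀ r, ‖χ r‖ ≤ ‖r‖) (hχM : ∀ i j, χ (M i j) = π (M i j))
    (hχt : ∀ i, χ (t i) = π (t i)) (r : R) : χ r = π r := by
  have hstate := hχ.isAlgState_cform hone hξ
  have hY : cform χ ξ (star M * M) = ‖star M * M‖ := by
    have h1 : ((‖star M * M‖ : ℝ) : ℂ) ≤ cform χ ξ (star M * M) := by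
      rw [← hM, cform_star_mul_self, Complex.ofReal_sum]
      have h2 : cform χ ξ (star M * M)
          = ∑ k, ∑ i, ∑ j, ⟪ξ i, χ (star (M k i) * M k j) (ξ j)⟫_ℂ := by
        rw [cform_apply]
        simp_rw [CStarMatrix.mul_apply, map_sum, sum_apply, inner_sum]
        rw [Finset.sum_comm_cycle]
        rfl
      rw [h2]
      refine Finset.sum_le_sum fun k _ => ?_
      simp_rw [← hχM]
      exact hχ.norm_sq_sum_le hone (fun j => M k j) ξ
    have h3 := Complex.le_def.1 h1
    apply Complex.ext
    · refine le_antisymm ?_ h3.1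
      rw [Complex.ofReal_re]
      exact (Complex.re_le_norm _).trans (hstate.norm_apply_le _)
    · exact h3.2.symm
  have hπw : ∀ w i, ⟪ξ i, π (star w * w) (ξ i)⟫_ℂ = ⟪π w (ξ i), π w (ξ i)⟫_ℂ := by
    intro w i
    rw [map_mul, map_star, mul_apply_eq_comp, ContinuousLinearMap.star_eq_adjoint,
      ContinuousLinearMap.adjoint_inner_right]
  have good : ∀ k i r, χ (r * codedWord t k) (ξ i) = χ r (π (codedWord t k) (ξ i)) := by
    intro k
    induction k using Nat.strong_induction_on with
    | _ k ih =>
      have hsame : ∀ m < k, ∀ i, χ (codedWord t m) (ξ i) = π (codedWord t m) (ξ i) := by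
        intro m hm i
        have := ih m hm i 1
        rwa [one_mul, hone, one_apply_eq_self] at this
      rcases codedWord_eq_one_or t k with h | ⟨a, m, hm, h⟩
      · intro i r
        rw [h, mul_one, map_one, one_apply_eq_self]
      · set w := codedWord t k with hw
        have hk : ∀ i, χ w (ξ i) = π w (ξ i) := by
          intro i
          rw [h, ih m hm i (t a), hχt, map_mul, mul_apply_eq_comp]
        have h1 := hmax _ hstate hY k fun m hm => by
          rw [cform_cdiag, cform_cdiag]
          congr 1
          refine Finset.sum_congr rfl fun i _ => ?_
          rw [ih m hm i, hχ.inner_map_star, hsame m hm]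
          exact (hπw _ i).symm
        rw [cform_cdiag, cform_cdiag, Complex.re_sum, Complex.re_sum] at h1
        have h2 : ∀ i, ⟪π w (ξ i), π w (ξ i)⟫_ℂ ≤ ⟪ξ i, χ (star w * w) (ξ i)⟫_ℂ := by
          intro i
          have := hχ.norm_sq_sum_le hone ![w] ![ξ i]
          simp only [Fin.sum_univ_one, Matrix.cons_val_fin_one] at this
          rw [hk] at this
          refine le_trans (le_of_eq ?_) this
          rw [inner_self_eq_norm_sq_to_K]
          norm_cast
        have h3 : ∀ i, (⟪π w (ξ i), π w (ξ i)⟫_ℂ).re = (⟪ξ i, χ (star w * w) (ξ i)⟫_ℂ).re := by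
          have h4 : ∑ i, (⟪π w (ξ i), π w (ξ i)⟫_ℂ).re
              = ∑ i, (⟪ξ i, χ (star w * w) (ξ i)⟫_ℂ).re := by
            refine le_antisymm (Finset.sum_le_sum fun i _ => (Complex.le_def.1 (h2 i)).1) ?_
            refine h1.trans (le_of_eq ?_)
            refine Finset.sum_congr rfl fun i _ => ?_
            exact congrArg Complex.re (hπw w i)
          intro i
          exact (Finset.sum_eq_sum_iff_of_le fun i _ => (Complex.le_def.1 (h2 i)).1).1 h4 i
            (Finset.mem_univ i)
        intro i r
        have h5 : ⟪ξ i, χ (star w * w) (ξ i)⟫_ℂ = ⟪χ w (ξ i), χ w (ξ i)⟫_ℂ := by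
          rw [hk]
          exact (Complex.ext (h3 i) (Complex.le_def.1 (h2 i)).2).symm
        rw [hχ.map_mul_of_eq hone h5, hk]
  have hχcont : Continuous χ :=
    (LipschitzWith.of_dist_le_mul (K := 1) fun x y => by
      rw [dist_eq_norm, dist_eq_norm, ← map_sub, NNReal.coe_one, one_mul]
      exact hbound (x - y)).continuous
  have hπcont : Continuous π :=
    (LipschitzWith.of_dist_le_mul (K := 1) fun x y => by
      rw [dist_eq_norm, dist_eq_norm, ← map_sub, NNReal.coe_one, one_mul]
      exact NonUnitalStarAlgHom.norm_apply_le π (x - y)).continuous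
  have good' : ∀ w i r, χ (r * w) (ξ i) = χ r (π w (ξ i)) := by
    intro w i r
    have h1 : (fun w => χ (r * w) (ξ i)) = fun w => χ r (π w (ξ i)) := by
      refine Continuous.ext_on ht ?_ ?_ ?_
      · exact (hχcont.comp (continuous_const.mul continuous_id)).clm_apply continuous_const
      · exact (χ r).continuous.comp (hπcont.clm_apply continuous_const)
      · intro w hw
        induction hw using Submodule.span_induction with
        | mem x hx =>
          obtain ⟨k, rfl⟩ := hx
          exact good k i r
        | zero => simp
        | add x y _ _ hx hy =>
          simp only [mul_add, map_add, add_apply] at hx hy ⊢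
          rw [hx, hy]
        | smul c x _ hx =>
          simp only [mul_smul_comm, map_smul, smul_apply] at hx ⊢
          rw [hx]
    exact congrFun h1 w
  rw [← sub_eq_zero]
  refine hcyc _ fun w i => ?_
  have h1 := good' (r * w) i 1
  rw [one_mul, hone, one_apply_eq_self, good' w i r, map_mul, mul_apply_eq_comp] at h1
  rw [sub_apply, h1, sub_self]

end UniqueExtension

section NormUnique

variable {D : Type*} [CStarAlgebra D] {q : D → ℝ}

theorem IsCstarSeminorm.le_norm (hq : IsCstarSeminorm q) (d : D) : q d ≤ ‖d‖ := by
  let := CStarAlgebra.spectralOrder D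
  have := CStarAlgebra.spectralOrderedRing D
  have hone : q 1 ≤ 1 := by
    have h := hq.cstar 1
    rw [star_one, one_mul] at h
    nlinarith [hq.nonneg 1]
  have hunit : ∀ u ∈ unitary D, q u ≤ 1 := by
    intro u hu
    have h := hq.cstar u
    rw [Unitary.star_mul_self_of_mem hu] at h
    nlinarith [hq.nonneg u]
  have hsa : ∀ a : D, IsSelfAdjoint a → ‖a‖ ≤ 1 → q a ≤ 1 := by
    intro a ha hn
    have hu := ha.self_add_I_smul_cfcSqrt_sub_sq_mem_unitary a hn
    have hs := Unitary.star_mem hu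
    have ht : IsSelfAdjoint (CFC.sqrt (1 - a ^ 2)) := (CFC.sqrt_nonneg (1 - a ^ 2)).isSelfAdjoint
    have e : a = (2⁻¹ : ℂ) • ((a + Complex.I • CFC.sqrt (1 - a ^ 2))
        + star (a + Complex.I • CFC.sqrt (1 - a ^ 2))) := by
      rw [star_add, star_smul, ha.star_eq, ht.star_eq]
      simp only [RCLike.star_def, Complex.conj_I]
      module
    rw [e, hq.smul]
    have h1 := hq.add_le (a + Complex.I • CFC.sqrt (1 - a ^ 2))
      (star (a + Complex.I • CFC.sqrt (1 - a ^ 2)))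
    have h2 := hunit _ hu
    have h3 := hunit _ hs
    rw [norm_inv, Complex.norm_ofNat]
    linarith
  have hsa' : ∀ a : D, IsSelfAdjoint a → q a ≤ ‖a‖ := by
    intro a ha
    by_cases h0 : a = 0
    · rw [h0, hq.map_zero', norm_zero]
    · have hpos : 0 < ‖a‖ := norm_pos_iff.2 h0
      have h1 := hsa (((‖a‖⁻¹ : ℝ) : ℂ) • a)
        (IsSelfAdjoint.smul (Complex.conj_ofReal _) ha) (by
          rw [norm_smul, Complex.norm_real, norm_inv, norm_norm, inv_mul_cancel₀ hpos.ne'])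
      rw [hq.smul, Complex.norm_real, norm_inv, norm_norm, inv_mul_le_iff₀ hpos, mul_one] at h1
      exact h1
  have h := hsa' (star d * d) (IsSelfAdjoint.star_mul_self d)
  rw [hq.cstar, CStarRing.norm_star_mul_self, ← sq] at h
  exact (sq_le_sq₀ (hq.nonneg d) (norm_nonneg d)).1 h

/-- A C*-norm on a C*-algebra is the given norm. -/
theorem IsCstarSeminorm.eq_norm (hq : IsCstarSeminorm q) (hker : ∀ d, q d = 0 → d = 0) (d : D) :
    q d = ‖d‖ := by
  refine le_antisymm (hq.le_norm d) ?_
  let := CStarAlgebra.spectralOrder D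
  have := CStarAlgebra.spectralOrderedRing D
  rcases subsingleton_or_nontrivial D with hD | hD
  · rw [Subsingleton.elim d 0, norm_zero]
    exact hq.nonneg _
  have hpos : ∀ a : D, 0 ≤ a → ‖a‖ ≤ q a := by
    intro a ha
    by_contra! hlt
    obtain ⟨r, hr1, hr2⟩ := exists_between hlt
    have hr0 : 0 < r := (hq.nonneg a).trans_lt hr1
    have hmax : ∀ x : ℝ, 0 < max x r := fun x => hr0.trans_le (le_max_right _ _)
    have hk : Continuous fun x : ℝ => (max x r)⁻¹ :=
      (continuous_id.max continuous_const).inv₀ fun x => (hmax x).ne'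
    have hf : Continuous fun x : ℝ => max (x - r) 0 := by fun_prop
    have e : cfc (fun x : ℝ => max (x - r) 0) a
        = cfc (fun x : ℝ => (max x r)⁻¹) a * a * cfc (fun x : ℝ => max (x - r) 0) a := by
      conv_rhs => enter [1, 2]; rw [← cfc_id' ℝ a]
      rw [← cfc_mul _ (fun x => x) a hk.continuousOn continuousOn_id,
        ← cfc_mul (fun x : ℝ => (max x r)⁻¹ * x) _ a (hk.mul continuous_id').continuousOn
          hf.continuousOn]
      refine cfc_congr fun x _ => ?_
      rcases le_total x r with h | h
      · simp [max_eq_right (sub_nonpos.2 h)]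
      · have hx : x ≠ 0 := (hr0.trans_le h).ne'
        simp [max_eq_left h, hx]
    set b := cfc (fun x : ℝ => max (x - r) 0) a with hb
    set k := cfc (fun x : ℝ => (max x r)⁻¹) a with hkdef
    have hkn : q k ≤ r⁻¹ := by
      refine (hq.le_norm k).trans (norm_cfc_le (inv_nonneg.2 hr0.le) fun x _ => ?_)
      rw [norm_inv, Real.norm_of_nonneg (hmax x).le]
      exact inv_anti₀ hr0 (le_max_right _ _)
    have hqb : q b = 0 := by
      have h1 : q b ≤ q k * q a * q b := by
        conv_lhs => rw [e]
        exact (hq.mul_le _ _).trans (mul_le_mul_of_nonneg_right (hq.mul_le _ _) (hq.nonneg _))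
      have h2 : q k * q a < 1 := by
        calc q k * q a ≤ r⁻¹ * q a := mul_le_mul_of_nonneg_right hkn (hq.nonneg _)
          _ < r⁻¹ * r := mul_lt_mul_of_pos_left hr1 (inv_pos.2 hr0)
          _ = 1 := inv_mul_cancel₀ hr0.ne'
      nlinarith [hq.nonneg b]
    have hb0 := hker b hqb
    have hmem : ‖a‖ ∈ spectrum ℝ a := CStarAlgebra.norm_mem_spectrum_of_nonneg ha
    have h3 := norm_apply_le_norm_cfc (fun x : ℝ => max (x - r) 0) a hmem hf.continuousOn
      ha.isSelfAdjoint
    rw [← hb, hb0, norm_zero, norm_le_zero_iff] at h3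
    have h4 := le_max_left (‖a‖ - r) 0
    linarith
  have h := hpos (star d * d) (star_mul_self_nonneg d)
  rw [hq.cstar, CStarRing.norm_star_mul_self, ← sq] at h
  exact (sq_le_sq₀ (norm_nonneg d) (hq.nonneg d)).1 h

/-- A C*-seminorm whose null space is the kernel of a surjective *-homomorphism onto a C*-algebra is
the pullback of the norm. -/
theorem IsCstarSeminorm.eq_norm_map {E : Type*} [Ring E] [StarRing E] [Algebra ℂ E] {s : E → ℝ}
    (hs : IsCstarSeminorm s) (Φ : E →⋆ₐ[ℂ] D) (hΦ : Function.Surjective Φ)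
    (hker : ∀ x, s x = 0 ↔ Φ x = 0) (x : E) : s x = ‖Φ x‖ := by
  have hle : ∀ x y, Φ x = Φ y → s x ≤ s y := by
    intro x y h
    have h1 := hs.add_le (x - y) y
    rw [sub_add_cancel, (hker (x - y)).2 (by rw [map_sub, h, sub_self]), zero_add] at h1
    exact h1
  have heq : ∀ x y, Φ x = Φ y → s x = s y := fun x y h => le_antisymm (hle x y h) (hle y x h.symm)
  let g := Function.surjInv hΦ
  have hg : ∀ d, Φ (g d) = d := Function.surjInv_eq hΦ
  have hq : IsCstarSeminorm fun d => s (g d) :=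
    { nonneg := fun d => hs.nonneg _
      map_zero' := (hker _).2 (hg 0)
      add_le := fun a b => by
        rw [heq (g (a + b)) (g a + g b) (by rw [map_add, hg, hg, hg])]
        exact hs.add_le _ _
      smul := fun c a => by
        rw [heq (g (c • a)) (c • g a) (by rw [map_smul, hg, hg])]
        exact hs.smul _ _
      mul_le := fun a b => by
        rw [heq (g (a * b)) (g a * g b) (by rw [map_mul, hg, hg, hg])]
        exact hs.mul_le _ _
      star_eq := fun a => by
        rw [heq (g (star a)) (star (g a)) (by rw [map_star, hg, hg])]
        exact hs.star_eq _
      cstar := fun a => by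
        rw [heq (g (star a * a)) (star (g a) * g a) (by rw [map_mul, map_star, hg, hg])]
        exact hs.cstar _ }
  rw [← hq.eq_norm (fun d hd => by rw [← hg d]; exact (hker _).1 hd) (Φ x)]
  exact heq _ _ (hg _).symm

end NormUnique

section MatrixHom

variable {A R : Type*} [Ring A] [StarRing A] [Algebra ℂ A] [CStarAlgebra R] {n : ℕ}

/-- The amplification of a *-homomorphism to matrix algebras. -/
def matrixHom (n : ℕ) (φ : A →⋆ₐ[ℂ] R) :
    Matrix (Fin n) (Fin n) A →⋆ₐ[ℂ] CStarMatrix (Fin n) (Fin n) R :=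
  (CStarMatrix.ofMatrixStarAlgEquiv :
      Matrix (Fin n) (Fin n) R ≃⋆ₐ[ℂ] _).toStarAlgHom.comp
    { AlgHom.mapMatrix (φ : A →ₐ[ℂ] R) with
      map_star' := fun M => by
        ext i j
        exact map_star φ (M j i) }

variable [PartialOrder R] [StarOrderedRing R]

theorem IsMatrixCstarSeminormFamily.eq_norm {p : A → ℝ}
    {pn : ∀ n : ℕ, Matrix (Fin n) (Fin n) A → ℝ} (hpn : IsMatrixCstarSeminormFamily p pn)
    {φ : A →⋆ₐ[ℂ] R} (hφ : Function.Surjective φ) (hnorm : ∀ a, ‖φ a‖ = p a)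
    (M : Matrix (Fin n) (Fin n) A) : pn n M = ‖matrixHom n φ M‖ := by
  refine (hpn.cstar n).eq_norm_map (matrixHom n φ) (fun x => ?_) (fun x => ?_) M
  · refine ⟨Matrix.of fun i j => Function.surjInv hφ (x i j), ?_⟩
    ext i j
    exact Function.surjInv_eq hφ _
  · rw [hpn.ker]
    simp_rw [← hnorm, norm_eq_zero]
    exact ⟨fun h => by ext i j; exact h i j, fun h i j => congrFun (congrFun h i) j⟩

end MatrixHom

section Boundary

theorem matOp_eq_zero_of_subsingleton {H : Type*} [NormedAddCommGroup H] [InnerProductSpace ℂ H]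
    (T : Matrix (Fin 0) (Fin 0) (H →L[ℂ] H)) : matOp T = 0 :=
  ContinuousLinearMap.ext fun _ => Subsingleton.elim _ _

theorem dense_span_codedWord {R : Type*} [CStarAlgebra R] {T : Set R} (hT : ∀ x ∈ T, star x ∈ T)
    (hdense : Dense (StarAlgebra.adjoin ℂ T : Set R)) {t : ℕ → R}
    (ht : T ⊆ closure (Set.range t)) :
    Dense (Submodule.span ℂ (Set.range (codedWord t)) : Set R) := by
  have h1 : (Algebra.adjoin ℂ (Set.range t) : Set R)
      ⊆ Submodule.span ℂ (Set.range (codedWord t)) := by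
    intro x hx
    have h2 : x ∈ Subalgebra.toSubmodule (Algebra.adjoin ℂ (Set.range t)) := hx
    rw [Algebra.adjoin_eq_span] at h2
    refine Submodule.span_mono ?_ h2
    intro y hy
    obtain ⟨l, hl, rfl⟩ := Submonoid.exists_list_of_mem_closure hy
    obtain ⟨l', rfl⟩ : l ∈ Set.range (List.map t) := by
      rw [Set.range_list_map]
      exact hl
    exact ⟨Encodable.encode l', by rw [codedWord, Denumerable.ofNat_encode]⟩
  have h3 : (StarAlgebra.adjoin ℂ T : Set R)
      ⊆ (Algebra.adjoin ℂ (Set.range t)).topologicalClosure := by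
    have hsub : T ∪ star T ⊆ (Algebra.adjoin ℂ (Set.range t)).topologicalClosure := by
      have hT' : T ⊆ (Algebra.adjoin ℂ (Set.range t)).topologicalClosure := fun x hx =>
        closure_mono Algebra.subset_adjoin (ht hx)
      refine Set.union_subset hT' fun x hx => hT' ?_
      simpa using hT _ (Set.mem_star.1 hx)
    exact Algebra.adjoin_le hsub
  refine Dense.mono h1 ?_
  have h4 := hdense.mono h3
  rw [Subalgebra.topologicalClosure_coe] at h4
  exact dense_closure.1 h4

variable {R : Type*} [CStarAlgebra R] [PartialOrder R] [StarOrderedRing R] {n : ℕ}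

/-- Every matrix norm is attained by an irreducible representation which is determined, among
contractive unital completely positive maps, by its values on the entries of the matrix and on a
generating sequence. -/
theorem exists_boundary_rep {t : ℕ → R}
    (ht : Dense (Submodule.span ℂ (Set.range (codedWord t)) : Set R))
    (M : CStarMatrix (Fin n) (Fin n) R) :
    ∃ (H : Type) (_ : NormedAddCommGroup H) (_ : InnerProductSpace ℂ H) (_ : CompleteSpace H)
      (ρ : R →⋆ₐ[ℂ] (H →L[ℂ] H)), HasTrivialCommutant ⇑ρ ∧
      (∀ χ : R →ₗ[ℂ] (H →L[ℂ] H), IsCstarCPmap χ → χ 1 = 1 → (∀ r, ‖χ r‖ ≤ ‖r‖) →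
        (∀ i j, χ (M i j) = ρ (M i j)) → (∀ i, χ (t i) = ρ (t i)) → ∀ r, χ r = ρ r) ∧
      ‖matOp ((CStarMatrix.ofMatrix.symm M).map ρ)‖ = ‖M‖ := by
  rcases subsingleton_or_nontrivial R with hR | hR
  · let H := EuclideanSpace ℂ (Fin 0)
    have hH : Subsingleton H := inferInstance
    have hB : Subsingleton (H →L[ℂ] H) := ⟨fun S T => ContinuousLinearMap.ext fun _ =>
      Subsingleton.elim _ _⟩
    let ρ : R →⋆ₐ[ℂ] (H →L[ℂ] H) :=
      { toFun := fun _ => 0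
        map_one' := Subsingleton.elim _ _
        map_mul' := fun _ _ => Subsingleton.elim _ _
        map_zero' := rfl
        map_add' := fun _ _ => Subsingleton.elim _ _
        commutes' := fun _ => Subsingleton.elim _ _
        map_star' := fun _ => Subsingleton.elim _ _ }
    refine ⟨H, inferInstance, inferInstance, inferInstance, ρ, fun _ _ => ⟨0, hB.elim _ _⟩,
      fun _ _ _ _ _ _ _ => hB.elim _ _, ?_⟩
    have h1 : M = 0 := by
      ext i j
      exact Subsingleton.elim _ _
    have h2 : matOp ((CStarMatrix.ofMatrix.symm M).map ρ) = 0 :=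
      ContinuousLinearMap.ext fun _ =>
        WithLp.ofLp_injective _ (funext fun _ => hH.elim _ _)
    rw [h2, h1, norm_zero, norm_zero]
  have hsep : TopologicalSpace.SeparableSpace R := by
    rw [← TopologicalSpace.isSeparable_univ_iff, ← ht.closure_eq]
    exact ((Set.countable_range _).isSeparable.span (R := ℂ)).closure
  have main : ∀ (m : ℕ) [NeZero m] (N : CStarMatrix (Fin m) (Fin m) R),
    ∃ (H : Type) (_ : NormedAddCommGroup H) (_ : InnerProductSpace ℂ H) (_ : CompleteSpace H)
      (ρ : R →⋆ₐ[ℂ] (H →L[ℂ] H)), HasTrivialCommutant ⇑ρ ∧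
      (∀ χ : R →ₗ[ℂ] (H →L[ℂ] H), IsCstarCPmap χ → χ 1 = 1 → (∀ r, ‖χ r‖ ≤ ‖r‖) →
        (∀ i j, χ (N i j) = ρ (N i j)) → (∀ i, χ (t i) = ρ (t i)) → ∀ r, χ r = ρ r) ∧
      ‖matOp ((CStarMatrix.ofMatrix.symm N).map ρ)‖ = ‖N‖ := by
    intro m _ N
    have : Nontrivial (CStarMatrix (Fin m) (Fin m) R) :=
      inferInstanceAs (Nontrivial (Fin m → Fin m → R))
    obtain ⟨f, hf, hfY, hext, hmax⟩ := exists_extreme_state_lexMax (star_mul_self_nonneg N)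
      fun k => cdiag (star (codedWord t k) * codedWord t k)
    obtain ⟨H, _, _, _, ρ, ξ, hfξ, hcyc⟩ := hf.exists_rep
    have hfc : f = cform (ρ : R →ₗ[ℂ] (H →L[ℂ] H)) ξ := LinearMap.ext hfξ
    have hξ : ∑ i, ⟪ξ i, ξ i⟫_ℂ = 1 := by
      rw [← hf.map_one, hfc]
      exact (cform_one (χ := (ρ : R →ₗ[ℂ] (H →L[ℂ] H))) (by simp) ξ).symm
    refine ⟨H, _, _, _, ρ, hasTrivialCommutant_of_extreme hf hext hfξ hcyc, ?_, ?_⟩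
    · subst hfc
      intro χ hχ hone hbound hχN hχt r
      exact eq_of_lexMax ht hξ hfY hmax hcyc hχ hone hbound hχN hχt r
    · subst hfc
      exact norm_matOp_map_eq ρ N hξ hfY
  rcases Nat.eq_zero_or_pos n with rfl | hn
  · obtain ⟨H, _, _, _, ρ, h1, h2, -⟩ := main 1 1
    refine ⟨H, _, _, _, ρ, h1, fun χ hχ hone hbound _ hχt => h2 χ hχ hone hbound ?_ hχt, ?_⟩
    · intro i j
      rw [Subsingleton.elim i j, CStarMatrix.one_apply_eq, hone, map_one]
    · have hM : M = 0 := by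
        ext i
        exact i.elim0
      rw [matOp_eq_zero_of_subsingleton, hM, norm_zero, norm_zero]
  · have : NeZero n := ⟨hn.ne'⟩
    exact main n M

end Boundary

section Factor

theorem exists_linearMap_factor {A R V : Type*} [AddCommGroup A] [Module ℂ A] [AddCommGroup R]
    [Module ℂ R] [AddCommGroup V] [Module ℂ V] {φ : A →ₗ[ℂ] R} (hφ : Function.Surjective φ)
    {ψ : A →ₗ[ℂ] V} (h : ∀ a, φ a = 0 → ψ a = 0) : ∃ χ : R →ₗ[ℂ] V, ∀ a, χ (φ a) = ψ a := by
  refine ⟨(φ.ker.liftQ ψ fun a ha => h a ha) ∘ₗ (φ.quotKerEquivOfSurjective hφ).symm, fun a => ?_⟩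
  have h1 : (φ.quotKerEquivOfSurjective hφ).symm (φ a) = φ.ker.mkQ a := by
    rw [LinearEquiv.symm_apply_eq]
    rfl
  change φ.ker.liftQ ψ (fun a ha => h a ha) ((φ.quotKerEquivOfSurjective hφ).symm (φ a)) = _
  rw [h1]
  rfl

theorem exists_starAlgHom_factor {A R V : Type*} [Ring A] [StarRing A] [Algebra ℂ A] [Ring R]
    [StarRing R] [Algebra ℂ R] [Ring V] [StarRing V] [Algebra ℂ V] {φ : A →⋆ₐ[ℂ] R}
    (hφ : Function.Surjective φ) {ψ : A →⋆ₐ[ℂ] V} (h : ∀ a, φ a = 0 → ψ a = 0) :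
    ∃ χ : R →⋆ₐ[ℂ] V, ∀ a, χ (φ a) = ψ a := by
  obtain ⟨χ, hχ⟩ := exists_linearMap_factor (φ := (φ : A →ₗ[ℂ] R)) hφ (ψ := (ψ : A →ₗ[ℂ] V)) h
  have hχ' : ∀ a, χ (φ a) = ψ a := hχ
  have hone : χ 1 = 1 := by rw [← map_one φ, hχ', map_one]
  refine ⟨{ AlgHom.ofLinearMap χ hone fun x y => ?_ with map_star' := fun x => ?_ }, hχ'⟩
  · obtain ⟨a, rfl⟩ := hφ x
    obtain ⟨b, rfl⟩ := hφ y
    rw [← map_mul, hχ', hχ', hχ', map_mul]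
  · obtain ⟨a, rfl⟩ := hφ x
    change χ (star (φ a)) = star (χ (φ a))
    rw [← map_star, hχ', hχ', map_star]

end Factor

/-- a separable local operator system has sufficiently many admissible local
boundary representations: each matrix seminorm is attained as a maximum over `Ch_λ(S)`. -/
theorem stmt14 {Λ : Type*} [Preorder Λ] {A : Type*} [Ring A] [StarRing A] [Algebra ℂ A] [StarModule ℂ A]
    {B : Λ → Type*} [∀ l, NormedRing (B l)] [∀ l, StarRing (B l)] [∀ l, CStarRing (B l)]
    [∀ l, NormedAlgebra ℂ (B l)] [∀ l, StarModule ℂ (B l)] [∀ l, CompleteSpace (B l)]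
    (p : Λ → A → ℝ) (hp : ∀ l, IsCstarSeminorm (p l))
    (hmono : ∀ ⦃l₁ l₂ : Λ⦄, l₁ ≤ l₂ → ∀ a, p l₁ a ≤ p l₂ a)
    (π : ∀ l, A →⋆ₐ[ℂ] B l) (hsurj : ∀ l, Function.Surjective ⇑(π l))
    (hnorm : ∀ l a, ‖(π l) a‖ = p l a)
    (pn : Λ → ∀ n : ℕ, Matrix (Fin n) (Fin n) A → ℝ)
    (hpn : ∀ l, IsMatrixCstarSeminormFamily (p l) (pn l))
    (S : Submodule ℂ A) (hSstar : ∀ s ∈ S, star s ∈ S) (hSone : (1 : A) ∈ S)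
    [TopologicalSpace A] (hind : Topology.IsInducing (fun a : A => fun l => (π l) a))
    (hgen : closure ((StarAlgebra.adjoin ℂ (S : Set A) : StarSubalgebra ℂ A) : Set A)
      = Set.univ)
    (hsep : TopologicalSpace.IsSeparable (S : Set A)) :
    ∀ (l : Λ) (n : ℕ) (M : Matrix (Fin n) (Fin n) ↥S),
      (∀ (H : Type) (_ : NormedAddCommGroup H) (_ : InnerProductSpace ℂ H)
        (_ : CompleteSpace H) (πr : A →⋆ₐ[ℂ] (H →L[ℂ] H)),
        IsAdmLocBdryRep p pn S πr → (∀ a : A, ‖πr a‖ ≤ p l a) →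
          ‖matOp (M.map fun s => πr (s : A))‖ ≤ pn l n (M.map Subtype.val)) ∧
      ∃ (H : Type) (_ : NormedAddCommGroup H) (_ : InnerProductSpace ℂ H)
        (_ : CompleteSpace H) (πr : A →⋆ₐ[ℂ] (H →L[ℂ] H)),
        IsAdmLocBdryRep p pn S πr ∧ (∀ a : A, ‖πr a‖ ≤ p l a) ∧
        ‖matOp (M.map fun s => πr (s : A))‖ = pn l n (M.map Subtype.val) := by
  intro l n M
  let : CStarAlgebra (B l) := { }
  let := CStarAlgebra.spectralOrder (B l)
  have := CStarAlgebra.spectralOrderedRing (B l)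
  have hker : ∀ a, p l a = 0 ↔ π l a = 0 := fun a => by rw [← hnorm, norm_eq_zero]
  have hpnM : pn l n (M.map Subtype.val) = ‖matrixHom n (π l) (M.map Subtype.val)‖ :=
    (hpn l).eq_norm (hsurj l) (hnorm l) _
  refine ⟨?_, ?_⟩
  · intro H _ _ _ πr _ hbound
    obtain ⟨ρ, hρ⟩ := exists_starAlgHom_factor (hsurj l) (ψ := πr) fun a ha =>
      norm_le_zero_iff.1 ((hbound a).trans_eq ((hker a).2 ha))
    have h1 : (M.map fun s => πr (s : A))
        = (CStarMatrix.ofMatrix.symm (matrixHom n (π l) (M.map Subtype.val))).map ρ :=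
      Matrix.ext fun i j => (hρ _).symm
    rw [h1, hpnM]
    exact norm_matOp_map_le ρ _
  · have hcont : Continuous (π l) := (continuous_apply l).comp hind.continuous
    have hTsep : TopologicalSpace.IsSeparable (π l '' S) := hsep.image hcont
    obtain ⟨c, hcT, hc, hTc⟩ := hTsep.exists_countable_dense_subset
    have hcne : c.Nonempty := by
      rw [← closure_nonempty_iff]
      exact ⟨_, hTc (Set.mem_image_of_mem _ hSone)⟩
    obtain ⟨t, rfl⟩ := hc.exists_eq_range hcne
    have hdense : Dense (StarAlgebra.adjoin ℂ (π l '' S) : Set (B l)) := by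
      have h1 : Dense ((StarAlgebra.adjoin ℂ (S : Set A) : StarSubalgebra ℂ A) : Set A) :=
        dense_iff_closure_eq.2 hgen
      have h2 := (hsurj l).denseRange.dense_image hcont h1
      rwa [← StarAlgHom.map_adjoin]
    have ht := dense_span_codedWord (T := π l '' S) (by
      rintro _ ⟨s, hs, rfl⟩
      exact ⟨star s, hSstar s hs, map_star _ _⟩) hdense hTc
    obtain ⟨H, _, _, _, ρ, hirr, huniq, hM⟩ :=
      exists_boundary_rep ht (matrixHom n (π l) (M.map Subtype.val))
    have hb : ∀ a, ‖ρ (π l a)‖ ≤ p l a := fun a =>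
      (NonUnitalStarAlgHom.norm_apply_le ρ (π l a)).trans_eq (hnorm l a)
    refine ⟨H, _, _, _, ρ.comp (π l), ⟨?_, l, hb, ?_⟩, hb, ?_⟩
    · intro T hT
      refine hirr T fun r => ?_
      obtain ⟨a, rfl⟩ := hsurj l r
      exact hT a
    · rintro φ hone ⟨l', hφ⟩ hφb hφS a
      obtain ⟨χ, hχ⟩ := exists_linearMap_factor (φ := (π l : A →ₗ[ℂ] B l)) (hsurj l) (ψ := φ)
        fun a ha => norm_le_zero_iff.1 ((hφb a).trans_eq ((hker a).2 ha))
      replace hχ : ∀ a, χ (π l a) = φ a := hχ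
      have hS : ∀ s ∈ S, χ (π l s) = ρ (π l s) := fun s hs => (hχ s).trans (hφS s hs)
      refine (hχ a).symm.trans (huniq χ ?_ ?_ ?_ ?_ ?_ (π l a))
      · rintro m _ ⟨x, rfl⟩
        have h1 := hφ.1 m _ ⟨Matrix.of fun i j => Function.surjInv (hsurj l) (x i j), 0,
          ((hpn l').cstar m).map_zero', rfl⟩
        have h2 : (star x * x).map χ
            = (star (Matrix.of fun i j => Function.surjInv (hsurj l) (x i j))
            * (Matrix.of fun i j => Function.surjInv (hsurj l) (x i j)) + 0).map φ := by
          refine Matrix.ext fun i j => ?_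
          rw [Matrix.map_apply, Matrix.map_apply, add_zero, Matrix.mul_apply, Matrix.mul_apply,
            ← hχ, map_sum, map_sum, map_sum]
          simp only [map_mul, Matrix.star_apply, map_star, Matrix.of_apply,
            Function.surjInv_eq]
        rwa [h2]
      · rw [← map_one (π l), hχ, hone]
      · intro r
        obtain ⟨b, rfl⟩ := hsurj l r
        rw [hχ, hnorm]
        exact hφb b
      · exact fun i j => hS _ (M i j).2
      · intro i
        obtain ⟨s, hs, h⟩ := hcT ⟨i, rfl⟩
        rw [← h]
        exact hS s hs
    · rw [hpnM, ← hM]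
      rfl
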